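/- arXiv:2406.17867 — 4 statements merged into one kernel-verified Lean document; each statement's English description precedes it below -/
import Mathlib

section
/- Every finite binary word z of length greater than 38 whose factor complexity satisfies ρ_z(i) ≤ 2i for all 1 ≤ i ≤ |z| contains a factor of exponent at least 5/2 (i.e., a nonempty factor whose length is at least 5/2 times its smallest period). -/
/-- The finite block of length `n` occurring at position `i` in the infinite word `x`. -/
def FactorAt {A : Type*} (x : ℕ → A) (i n : ℕ) : List A :=
  (List.range n).map fun t => x (i + t)

/-- `w` is a (finite) factor of the infinite word `x`. -/
def IsFactor {A : Type*} (x : ℕ → A) (w : List A) : Prop :=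
  ∃ i, w = FactorAt x i w.length

/-- Factor complexity of an infinite word: the number of distinct factors of length `n`. -/
noncomputable def complexity {A : Type*} (x : ℕ → A) (n : ℕ) : ℕ :=
  Set.ncard {w : List A | w.length = n ∧ IsFactor x w}

/-- Factor complexity of a finite word: the number of distinct factors of length `n`. -/
noncomputable def complexityF {A : Type*} (z : List A) (n : ℕ) : ℕ :=
  Set.ncard {w : List A | w.length = n ∧ w <:+: z}

/-- `p` is a period of the finite word `y`:  `1 ≤ p ≤ |y|` and `y[j] = y[j+p]`
for all `0 ≤ j < |y| - p`. -/
def HasPeriod {A : Type*} [Inhabited A] (y : List A) (p : ℕ) : Prop :=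
  1 ≤ p ∧ p ≤ y.length ∧ ∀ j, j + p < y.length → y.getD j default = y.getD (j + p) default

/-- The smallest period of a finite word. -/
noncomputable def minPeriod {A : Type*} [Inhabited A] (y : List A) : ℕ :=
  sInf {p | HasPeriod y p}

/-- The exponent of a finite word: its length divided by its smallest period. -/
noncomputable def exponent {A : Type*} [Inhabited A] (y : List A) : ℚ :=
  (y.length : ℚ) / (minPeriod y : ℚ)

/-- The critical exponent of an infinite word: the supremum of the exponents of its
nonempty finite factors. -/
noncomputable def criticalExponent {A : Type*} [Inhabited A] (x : ℕ → A) : ENNReal :=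
  sSup {e : ENNReal | ∃ w, IsFactor x w ∧ w ≠ [] ∧ e = ENNReal.ofReal ((exponent w : ℚ) : ℝ)}

/-- The image of a finite word under a morphism given by its action on letters. -/
def mapWord {k : ℕ} {A : Type*} (σ : Fin k → List A) (w : List (Fin k)) : List A :=
  (w.map σ).flatten

/-- The image of an infinite word under a (nonerasing) morphism given by its action on
letters: the `n`-th letter of the concatenation `σ (x 0) ++ σ (x 1) ++ ⋯`. -/
def applyMorph {k : ℕ} {A : Type*} [Inhabited A] (σ : Fin k → List A) (x : ℕ → Fin k) :
    ℕ → A :=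
  fun n => (((List.range (n + 1)).map fun i => σ (x i)).flatten).getD n default

/-- The morphism `h` with `h(0) = 01`, `h(1) = 21`, `h(2) = 0`. -/
def hm : Fin 3 → List (Fin 3) := ![[0, 1], [2, 1], [0]]

/-- The morphism `g` with `g(0) = 011`, `g(1) = 0`, `g(2) = 01`. -/
def gm : Fin 3 → List (Fin 2) := ![[0, 1, 1], [0], [0, 1]]

/-- The abelian complexity of a binary infinite word at `n`: the number of distinct
values taken by the count of `0`'s among its length-`n` factors. -/
noncomputable def abelianComplexity (x : ℕ → Fin 2) (n : ℕ) : ℕ :=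
  Set.ncard {z : ℕ | ∃ i, z = (FactorAt x i n).count 0}

/-- The natural number whose binary digits, least significant first, are the letters of `w`. -/
def encode : List (Fin 2) → ℕ
  | [] => 0
  | a :: w => 2 * encode w + a

/-- The word of length `n` encoded by `e` has, for some small `p`, a prefix of period `p` and
length at least `5 * p / 2`. -/
def startsWithPower (n e : ℕ) : Bool :=
  [(1, 2), (2, 3), (3, 5), (4, 6), (6, 9), (7, 11), (8, 12), (10, 15), (13, 20)].any fun q =>
    Nat.beq (e % 2 ^ q.2) (e / 2 ^ q.1 % 2 ^ q.2) && Nat.ble (q.1 + q.2) n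

/-- Backtracking search which extends the word of length `n` encoded by `e` to the left by up to
`k` letters, discarding words that start with a power or have more than eight factors of length
four. The list `S` records the encodings of the factors of length four met so far. The result is
`true` if every branch is discarded. -/
def searchFails : ℕ → ℕ → ℕ → List ℕ → Bool
  | 0, _, _, _ => false
  | k + 1, n, e, S => [0, 1].all fun a =>
      startsWithPower (n + 1) (2 * e + a) ||
        bif Nat.ble n 2 || S.any (Nat.beq ((2 * e + a) % 16)) then
          searchFails k (n + 1) (2 * e + a) S
        else S.length.beq 8 || searchFails k (n + 1) (2 * e + a) ((2 * e + a) % 16 :: S)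

theorem encode_take (w : List (Fin 2)) (m : ℕ) : encode (w.take m) = encode w % 2 ^ m := by
  induction w generalizing m with
  | nil => simp [encode]
  | cons a w ih =>
    cases m with
    | zero => simp [encode, Nat.mod_one]
    | succ m =>
      rw [List.take_succ_cons, encode, encode, ih, pow_succ', Nat.mod_mul]
      have := a.isLt
      rw [show (2 * encode w + a) % 2 = a by omega, show (2 * encode w + a) / 2 = encode w by omega]
      ring

theorem encode_drop (w : List (Fin 2)) (p : ℕ) : encode (w.drop p) = encode w / 2 ^ p := by
  induction p generalizing w with
  | zero => simp
  | succ p ih =>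
    cases w with
    | nil => simp [encode]
    | cons a w =>
      rw [List.drop_succ_cons, ih, encode, pow_succ', ← Nat.div_div_eq_div_mul]
      congr 1
      omega

theorem encode_inj {v w : List (Fin 2)} (hlen : v.length = w.length)
    (h : encode v = encode w) : v = w := by
  induction v generalizing w with
  | nil => exact (List.length_eq_zero_iff.1 hlen.symm).symm
  | cons a v ih =>
    obtain _ | ⟨b, w⟩ := w
    · simp at hlen
    simp only [encode] at h
    rw [ih (by simpa using hlen) (by omega), Fin.ext (by omega : a.val = b.val)]

theorem finite_factors {A : Type*} (z : List A) (n : ℕ) :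
    {w : List A | w.length = n ∧ w <:+: z}.Finite :=
  z.sublists.finite_toSet.subset fun _ hw => List.mem_sublists.2 hw.2.sublist

theorem le_complexityF {A : Type*} [DecidableEq A] {z : List A} {n : ℕ} {S : List (List A)}
    (hS : S.Nodup) (h : ∀ u ∈ S, u.length = n ∧ u <:+: z) : S.length ≤ complexityF z n := by
  rw [← List.toFinset_card_of_nodup hS, ← Set.ncard_coe_finset]
  exact Set.ncard_le_ncard (fun u hu => h u (by simpa using hu)) (finite_factors z n)

theorem le_exponent {A : Type*} [Inhabited A] {y : List A} {p : ℕ} (h : HasPeriod y p) :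
    (y.length : ℚ) / p ≤ exponent y := by
  have hmem : HasPeriod y (minPeriod y) := Nat.sInf_mem (s := {p | HasPeriod y p}) ⟨p, h⟩
  have hle : minPeriod y ≤ p := Nat.sInf_le h
  have hpos : (0 : ℚ) < minPeriod y := by exact_mod_cast hmem.1
  unfold exponent
  gcongr

theorem hasPeriod_take {A : Type*} [Inhabited A] {w : List A} {m p : ℕ} (hp : 1 ≤ p)
    (hpm : p + m ≤ w.length) (h : w.take m <+: w.drop p) : HasPeriod (w.take (p + m)) p := by
  refine ⟨hp, by simp; omega, fun j hj => ?_⟩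
  have hj' : j < m := by simp at hj; omega
  have := h.getElem (i := j) (by simp; omega)
  rw [List.getD_eq_getElem _ _ (by simp; omega), List.getD_eq_getElem _ _ hj]
  simpa [add_comm] using this

theorem exists_exponent_of_startsWithPower {w : List (Fin 2)}
    (h : startsWithPower w.length (encode w) = true) :
    ∃ y : List (Fin 2), y <:+: w ∧ y ≠ [] ∧ (5 : ℚ) / 2 ≤ exponent y := by
  obtain ⟨⟨p, m⟩, hq, hpow⟩ := List.any_eq_true.1 h
  have hq' : 1 ≤ p ∧ 3 * p ≤ 2 * m := by
    simp only [List.mem_cons, Prod.mk.injEq, List.not_mem_nil, or_false] at hq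
    omega
  obtain ⟨hp, hm⟩ := hq'
  simp only [Bool.and_eq_true, Nat.beq_eq, Nat.ble_eq] at hpow
  obtain ⟨hpow, hpm⟩ := hpow
  have hpre : w.take m <+: w.drop p := by
    rw [encode_inj (v := w.take m) (w := (w.drop p).take m) (by simp; omega)
      (by rw [encode_take, encode_take, encode_drop, hpow])]
    exact List.take_prefix _ _
  have hy : (w.take (p + m)).length = p + m := by simpa using hpm
  refine ⟨w.take (p + m), (List.take_prefix _ _).isInfix, ?_, ?_⟩
  · rw [← List.length_pos_iff]
    omega
  · refine le_trans ?_ (le_exponent (hasPeriod_take hp hpm hpre))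
    have hp0 : (0 : ℚ) < p := by exact_mod_cast hp
    rw [hy, div_le_div_iff₀ two_pos hp0]
    exact_mod_cast (by omega : 5 * p ≤ (p + m) * 2)

theorem exists_cons_suffix {A : Type*} {w z : List A} (h : w <:+ z) (hlt : w.length < z.length) :
    ∃ a, a :: w <:+ z := by
  obtain ⟨t, rfl⟩ := h
  have ht : t ≠ [] := by
    rintro rfl
    simp at hlt
  refine ⟨t.getLast ht, t.dropLast, ?_⟩
  conv_rhs => rw [← List.dropLast_append_getLast ht]
  simp

theorem exists_exponent_of_searchFails {z : List (Fin 2)} (hz : complexityF z 4 ≤ 8) {k : ℕ}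
    {w : List (Fin 2)} {S : List (List (Fin 2))}
    (hsearch : searchFails k w.length (encode w) (S.map encode) = true)
    (hw : w <:+ z) (hlen : w.length + k ≤ z.length) (hS : S.Nodup)
    (hSz : ∀ u ∈ S, u.length = 4 ∧ u <:+: z) :
    ∃ y : List (Fin 2), y <:+: z ∧ y ≠ [] ∧ (5 : ℚ) / 2 ≤ exponent y := by
  induction k generalizing w S with
  | zero => simp [searchFails] at hsearch
  | succ k ih =>
    obtain ⟨a, ha⟩ := exists_cons_suffix hw (by omega)
    have hlen' : (a :: w).length + k ≤ z.length := by
      simp only [List.length_cons]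
      omega
    rw [searchFails, List.all_eq_true] at hsearch
    have hsa := hsearch a.val (by fin_cases a <;> simp)
    have htake : encode ((a :: w).take 4) = (2 * encode w + a) % 16 := encode_take (a :: w) 4
    rw [← htake] at hsa
    change (startsWithPower (a :: w).length (encode (a :: w)) ||
      bif _ then searchFails k (a :: w).length (encode (a :: w)) (S.map encode)
      else _ || searchFails k (a :: w).length (encode (a :: w))
        (((a :: w).take 4 :: S).map encode)) = true at hsa
    rcases Bool.or_eq_true_iff.1 hsa with hpow | hext
    · obtain ⟨y, hy, hy'⟩ := exists_exponent_of_startsWithPower hpow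
      exact ⟨y, hy.trans ha.isInfix, hy'⟩
    rw [Bool.cond_eq_ite] at hext
    split_ifs at hext with hold
    · exact ih hext ha hlen' hS hSz
    · have hnew : ((a :: w).take 4 :: S).Nodup ∧
          ∀ u ∈ (a :: w).take 4 :: S, u.length = 4 ∧ u <:+: z := by
        rw [Bool.or_eq_true_iff, not_or, Nat.ble_eq, List.any_eq_true] at hold
        refine ⟨List.nodup_cons.2 ⟨fun hmem => hold.2 ?_, hS⟩,
          List.forall_mem_cons.2 ⟨⟨?_, ?_⟩, hSz⟩⟩
        · exact ⟨_, List.mem_map_of_mem hmem, Nat.beq_refl _⟩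
        · simp only [List.length_take, List.length_cons]
          omega
        · exact (List.take_prefix _ _).isInfix.trans ha.isInfix
      rcases Bool.or_eq_true_iff.1 hext with hfull | hrec
      · have := le_complexityF hnew.1 hnew.2
        rw [Nat.beq_eq, List.length_map] at hfull
        rw [List.length_cons, hfull] at this
        omega
      · exact ih hrec ha hlen' hnew.1 hnew.2

theorem searchFails_start : searchFails 39 0 0 [] = true := by
  decide +kernel

/-- Every finite binary Rote word of length greater than 38 contains a nonempty factor
of exponent at least 5/2. -/
theorem stmt0 (z : List (Fin 2)) (hlen : z.length > 38)
    (hrote : ∀ i, 1 ≤ i → i ≤ z.length → complexityF z i ≤ 2 * i) :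
    ∃ w : List (Fin 2), w <:+: z ∧ w ≠ [] ∧ (5 : ℚ) / 2 ≤ exponent w := by
  exact exists_exponent_of_searchFails (hrote 4 (by norm_num) (by omega)) (w := []) (S := [])
    searchFails_start List.nil_suffix (by simpa using Nat.succ_le_of_lt hlen) List.nodup_nil
    (by simp)
end

section
/- Every infinite binary sequence x whose factor complexity satisfies ρ_x(n) = 2n for all n ≥ 1 contains a finite factor of exponent at least 5/2. -/
/-- The word of length `n` with binary code `c` (first letter in the lowest bit) starts with a
factor of length `(5 * p + 1) / 2` having period `p`. -/
def startsWithRepetition (n c p : ℕ) : Bool :=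
  Nat.ble (5 * p) (2 * n) &&
    Nat.beq (c / 2 ^ p % 2 ^ ((3 * p + 1) / 2)) (c % 2 ^ ((3 * p + 1) / 2))

/-- Backtracking search over the binary words obtained by adding at most `k` letters to the left of
the word of length `n` with code `c`, where `S` lists the codes of the factors of length 4 met so
far. The value is `true` when every branch runs into a prefix of exponent at least 5/2 or a ninth
factor of length 4. -/
def leftExtensionsRefuted : ℕ → ℕ → ℕ → List ℕ → Bool
  | 0, _, _, _ => false
  | k + 1, n, c, S => [2 * c, 2 * c + 1].all fun d =>
      [1, 2, 3, 4, 6, 7, 8, 10, 13].any (startsWithRepetition (n + 1) d) ||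
      bif Nat.ble 3 n && !S.any (Nat.beq (d % 16)) then
        Nat.ble 8 S.length || leftExtensionsRefuted k (n + 1) d (d % 16 :: S)
      else leftExtensionsRefuted k (n + 1) d S

theorem leftExtensionsRefuted_empty : leftExtensionsRefuted 39 0 0 [] = true := by
  decide +kernel

/-- The low `n` bits of `c` encode the factor of length `n` of `x` at position `i`. -/
def EncodesFactorAt (x : ℕ → Fin 2) (i n c : ℕ) : Prop :=
  ∀ t < n, c.testBit t = decide (x (i + t) = 1)

theorem EncodesFactorAt.cons {x : ℕ → Fin 2} {i n c : ℕ} (h : EncodesFactorAt x (i + 1) n c) :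
    EncodesFactorAt x i (n + 1) (2 * c + (x i).val) := by
  have hxi := (x i).isLt
  rintro (_ | t) ht
  · rw [Nat.testBit_zero, Nat.add_zero, decide_eq_decide, Fin.ext_iff, Fin.val_one]
    omega
  · rw [Nat.testBit_succ, show (2 * c + (x i).val) / 2 = c by omega, h t (by omega),
      show i + 1 + t = i + (t + 1) by omega]

theorem length_factorAt {A : Type*} (x : ℕ → A) (i n : ℕ) : (FactorAt x i n).length = n := by
  simp [FactorAt]

theorem isFactor_factorAt {A : Type*} (x : ℕ → A) (i n : ℕ) : IsFactor x (FactorAt x i n) :=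
  ⟨i, by rw [length_factorAt]⟩

theorem getD_factorAt {A : Type*} (x : ℕ → A) (i : ℕ) {n j : ℕ} (hj : j < n) (a : A) :
    (FactorAt x i n).getD j a = x (i + j) := by
  simp [FactorAt, hj]

/-- A word with a period `p` such that `5 * p ≤ 2 * y.length` has exponent at least 5/2. -/
theorem five_halves_le_exponent {A : Type*} [Inhabited A] {y : List A} {p : ℕ}
    (hp : HasPeriod y p) (hlen : 5 * p ≤ 2 * y.length) : (5 : ℚ) / 2 ≤ exponent y := by
  have hmin : minPeriod y ≤ p := Nat.sInf_le hp
  have hpos : 1 ≤ minPeriod y := (Nat.sInf_mem (s := {p | HasPeriod y p}) ⟨p, hp⟩).1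
  have hpos' : (0 : ℚ) < minPeriod y := by exact_mod_cast hpos
  have h : (5 * minPeriod y : ℚ) ≤ 2 * y.length := by
    exact_mod_cast (Nat.mul_le_mul_left 5 hmin).trans hlen
  rw [exponent, le_div_iff₀ hpos']
  linarith

theorem exists_exponent_of_startsWithRepetition {x : ℕ → Fin 2} {i n c p : ℕ} (hp : 1 ≤ p)
    (hc : EncodesFactorAt x i n c) (h : startsWithRepetition n c p = true) :
    ∃ w : List (Fin 2), IsFactor x w ∧ w ≠ [] ∧ (5 : ℚ) / 2 ≤ exponent w := by
  rw [startsWithRepetition, Bool.and_eq_true, Nat.ble_eq, Nat.beq_eq] at h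
  obtain ⟨hn, hmod⟩ := h
  have hlen := length_factorAt x i (p + (3 * p + 1) / 2)
  refine ⟨FactorAt x i (p + (3 * p + 1) / 2), isFactor_factorAt x _ _, ?_,
    five_halves_le_exponent (p := p) ⟨hp, by omega, fun j hj => ?_⟩ (by omega)⟩
  · rw [← List.length_pos_iff]
    omega
  · rw [hlen] at hj
    rw [getD_factorAt x i (by omega), getD_factorAt x i hj]
    have hbit := congrArg (Nat.testBit · j) hmod
    have hj' : j < (3 * p + 1) / 2 := by omega
    simp only [Nat.testBit_mod_two_pow, Nat.testBit_div_two_pow, hj', decide_true,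
      Bool.true_and] at hbit
    rw [hc _ (by omega), hc _ (by omega), decide_eq_decide] at hbit
    omega

/-- A duplicate-free list of factors of length `n` is no longer than the complexity at `n`. -/
theorem length_le_complexity {A : Type*} {x : ℕ → A} {n : ℕ} (hn : complexity x n ≠ 0)
    {S : List (List A)} (hS : S.Nodup) (hfac : ∀ s ∈ S, s.length = n ∧ IsFactor x s) :
    S.length ≤ complexity x n := by
  classical
  rw [← List.toFinset_card_of_nodup hS, ← Set.ncard_coe_finset]
  exact Set.ncard_le_ncard (fun s hs => hfac s (List.mem_toFinset.1 hs))
    (Set.finite_of_ncard_ne_zero hn)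

/-- A duplicate-free list of codes of factors of length `n` is no longer than the complexity
at `n`. -/
theorem length_le_complexity_of_encodes {x : ℕ → Fin 2} {n : ℕ} (hn : complexity x n ≠ 0)
    {S : List ℕ} (hS : S.Nodup) (hfac : ∀ s ∈ S, s < 2 ^ n ∧ ∃ j, EncodesFactorAt x j n s) :
    S.length ≤ complexity x n := by
  let decode (s : ℕ) : List (Fin 2) := FactorAt (fun t => if s.testBit t then 1 else 0) 0 n
  rw [← List.length_map (f := decode)]
  refine length_le_complexity hn (hS.map_on fun s hs s' hs' heq => ?_) fun w hw => ?_
  · refine Nat.eq_of_testBit_eq fun t => ?_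
    rcases lt_or_ge t n with ht | ht
    · have hget := congrArg (List.getD · t 0) heq
      simp only [decode, getD_factorAt _ _ ht, Nat.zero_add] at hget
      cases h : s.testBit t <;> cases h' : s'.testBit t <;> simp [h, h'] at hget ⊢
    · have hpow := Nat.pow_le_pow_right Nat.two_pos ht
      rw [Nat.testBit_lt_two_pow ((hfac s hs).1.trans_le hpow),
        Nat.testBit_lt_two_pow ((hfac s' hs').1.trans_le hpow)]
  · obtain ⟨s, hs, rfl⟩ := List.mem_map.1 hw
    obtain ⟨j, hj⟩ := (hfac s hs).2
    have hdecode : decode s = FactorAt x j n := by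
      refine List.map_congr_left fun t ht => ?_
      have hcases : ∀ a : Fin 2, (if decide (a = 1) = true then (1 : Fin 2) else 0) = a := by
        decide
      simp only [Nat.zero_add, hj t (List.mem_range.1 ht)]
      exact hcases _
    rw [hdecode]
    exact ⟨length_factorAt x j n, isFactor_factorAt x j n⟩

theorem exists_exponent_of_leftExtensionsRefuted {x : ℕ → Fin 2} (hx : complexity x 4 = 8)
    {k i n c : ℕ} (hki : k ≤ i) (hc : EncodesFactorAt x i n c) {S : List ℕ} (hS : S.Nodup)
    (hfac : ∀ s ∈ S, s < 2 ^ 4 ∧ ∃ j, EncodesFactorAt x j 4 s)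
    (h : leftExtensionsRefuted k n c S = true) :
    ∃ w : List (Fin 2), IsFactor x w ∧ w ≠ [] ∧ (5 : ℚ) / 2 ≤ exponent w := by
  induction k generalizing i n c S with
  | zero => simp [leftExtensionsRefuted] at h
  | succ k ih =>
    obtain ⟨i, rfl⟩ : ∃ j, i = j + 1 := ⟨i - 1, by omega⟩
    have hd := hc.cons
    have hmem : 2 * c + (x i).val ∈ [2 * c, 2 * c + 1] := by
      have := (x i).isLt
      simp only [List.mem_cons, List.not_mem_nil, or_false]
      omega
    rw [leftExtensionsRefuted, List.all_eq_true] at h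
    have hb := h _ hmem
    generalize 2 * c + (x i).val = d at hd hb
    rw [Bool.or_eq_true, List.any_eq_true] at hb
    rcases hb with ⟨p, hp, hrep⟩ | hb
    · refine exists_exponent_of_startsWithRepetition ?_ hd hrep
      simp only [List.mem_cons, List.not_mem_nil, or_false] at hp
      omega
    · cases hnew : Nat.ble 3 n && !S.any (Nat.beq (d % 16)) with
      | false =>
        rw [hnew, cond_false] at hb
        exact ih (by omega) hd hS hfac hb
      | true =>
        rw [hnew, cond_true, Bool.or_eq_true, Nat.ble_eq] at hb
        simp only [Bool.and_eq_true, Nat.ble_eq, Bool.not_eq_true', List.any_eq_false,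
          Nat.beq_eq] at hnew
        have hS' : (d % 16 :: S).Nodup := List.nodup_cons.2 ⟨fun hm => hnew.2 _ hm rfl, hS⟩
        have hfac' : ∀ s ∈ d % 16 :: S, s < 2 ^ 4 ∧ ∃ j, EncodesFactorAt x j 4 s := by
          refine List.forall_mem_cons.2 ⟨⟨Nat.mod_lt _ (by norm_num), i, fun t ht => ?_⟩, hfac⟩
          rw [show 16 = 2 ^ 4 by norm_num, Nat.testBit_mod_two_pow, decide_eq_true ht,
            Bool.true_and, hd t (by omega)]
        rcases hb with hb | hb
        · have hle := length_le_complexity_of_encodes (by omega) hS' hfac'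
          rw [List.length_cons] at hle
          omega
        · exact ih (by omega) hd hS' hfac' hb

/-- Every infinite binary sequence of factor complexity `2n` contains a nonempty finite
factor of exponent at least 5/2. -/
theorem stmt1 (x : ℕ → Fin 2) (hrote : ∀ n, 1 ≤ n → complexity x n = 2 * n) :
    ∃ w : List (Fin 2), IsFactor x w ∧ w ≠ [] ∧ (5 : ℚ) / 2 ≤ exponent w := by
  have hzero : EncodesFactorAt x 39 0 0 := fun t ht => absurd ht t.not_lt_zero
  exact exists_exponent_of_leftExtensionsRefuted (hrote 4 (by norm_num)) le_rfl hzero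
    List.nodup_nil (by simp) leftExtensionsRefuted_empty
end

section
/- The infinite binary word q = g(p) is (5/2)^+-power-free: no nonempty finite factor of q has exponent strictly greater than 5/2. Equivalently, there do not exist indices i ≥ 0 and n ≥ 1 such that q[t] = q[t+n] for all t with i ≤ t ≤ i + 3n/2. -/
/-- The position in `σ (x 0) ++ σ (x 1) ++ ⋯` at which the block `σ (x k)` starts. -/
def blockStart {k : ℕ} {A : Type*} (σ : Fin k → List A) (x : ℕ → Fin k) : ℕ → ℕ
  | 0 => 0
  | n + 1 => blockStart σ x n + (σ (x n)).length

lemma length_flatten_blocks {k : ℕ} {A : Type*} (σ : Fin k → List A) (x : ℕ → Fin k) (n : ℕ) :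
    (((List.range n).map fun i => σ (x i)).flatten).length = blockStart σ x n := by
  induction n with
  | zero => simp [blockStart]
  | succ n ih =>
    rw [List.range_succ, List.map_append, List.flatten_append, List.length_append, ih]
    simp [blockStart]

lemma le_blockStart {k : ℕ} {A : Type*} {σ : Fin k → List A} (hσ : ∀ c, 1 ≤ (σ c).length)
    (x : ℕ → Fin k) (n : ℕ) : n ≤ blockStart σ x n := by
  induction n with
  | zero => simp
  | succ n ih =>
    have := hσ (x n)
    simp only [blockStart]
    omega

lemma getD_flatten_blocks {k : ℕ} {A : Type*} [Inhabited A] (σ : Fin k → List A)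
    (x : ℕ → Fin k) (n t d : ℕ) (ht : t < (σ (x n)).length) :
    (((List.range (n + 1 + d)).map fun i => σ (x i)).flatten).getD (blockStart σ x n + t) default
      = (σ (x n)).getD t default := by
  induction d with
  | zero =>
    rw [Nat.add_zero, List.range_succ, List.map_append, List.flatten_append,
      List.getD_append_right _ _ _ _ (by rw [length_flatten_blocks]; omega),
      length_flatten_blocks]
    simp
  | succ d ih =>
    have hmono : blockStart σ x (n + 1) ≤ blockStart σ x (n + 1 + d) :=
      monotone_nat_of_le_succ (f := blockStart σ x)
        (fun m => by simp only [blockStart]; omega) (by omega)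
    simp only [blockStart] at hmono
    rw [← Nat.add_assoc, List.range_succ, List.map_append, List.flatten_append,
      List.getD_append _ _ _ _ (by rw [length_flatten_blocks]; omega)]
    exact ih

/-- The letters of the image word inside the block `σ (x n)`. -/
lemma applyMorph_blockStart_add {k : ℕ} {A : Type*} [Inhabited A] {σ : Fin k → List A}
    (hσ : ∀ c, 1 ≤ (σ c).length) (x : ℕ → Fin k) (n t : ℕ) (ht : t < (σ (x n)).length) :
    applyMorph σ x (blockStart σ x n + t) = (σ (x n)).getD t default := by
  have h := le_blockStart hσ x n
  obtain ⟨d, hd⟩ : ∃ d, blockStart σ x n + t + 1 = n + 1 + d :=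
    ⟨blockStart σ x n + t - n, by omega⟩
  rw [applyMorph, hd]
  exact getD_flatten_blocks σ x n t d ht

lemma exists_block {k : ℕ} {A : Type*} {σ : Fin k → List A} (hσ : ∀ c, 1 ≤ (σ c).length)
    (x : ℕ → Fin k) (i : ℕ) :
    ∃ n t, t < (σ (x n)).length ∧ i = blockStart σ x n + t := by
  induction i with
  | zero => exact ⟨0, 0, hσ _, rfl⟩
  | succ i ih =>
    obtain ⟨n, t, ht, rfl⟩ := ih
    by_cases h : t + 1 < (σ (x n)).length
    · exact ⟨n, t + 1, h, by omega⟩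
    · exact ⟨n + 1, 0, hσ _, by simp only [blockStart]; omega⟩

lemma blockStart_strictMono {k : ℕ} {A : Type*} {σ : Fin k → List A}
    (hσ : ∀ c, 1 ≤ (σ c).length) (x : ℕ → Fin k) : StrictMono (blockStart σ x) :=
  strictMono_nat_of_lt_succ fun n => by
    have := hσ (x n)
    simp only [blockStart]
    omega

/-- Equal stretches of `x` have equal images. -/
lemma applyMorph_eq_of_match {k : ℕ} {A : Type*} [Inhabited A] {σ : Fin k → List A}
    (hσ : ∀ c, 1 ≤ (σ c).length) (x : ℕ → Fin k) (a b L : ℕ)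
    (hm : ∀ s < L, x (a + s) = x (b + s)) :
    ∃ m, blockStart σ x (a + L) = blockStart σ x a + m ∧
      blockStart σ x (b + L) = blockStart σ x b + m ∧
      ∀ t < m, applyMorph σ x (blockStart σ x a + t) = applyMorph σ x (blockStart σ x b + t) := by
  induction L with
  | zero => exact ⟨0, rfl, rfl, by simp⟩
  | succ L ih =>
    obtain ⟨m, h1, h2, h3⟩ := ih fun s hs => hm s (by omega)
    have hx := hm L (by omega)
    refine ⟨m + (σ (x (a + L))).length, ?_, ?_, ?_⟩
    · rw [← Nat.add_assoc, ← Nat.add_assoc, ← h1, blockStart]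
    · rw [← Nat.add_assoc, ← Nat.add_assoc, ← h2, hx, blockStart]
    · intro t ht
      by_cases htm : t < m
      · exact h3 t htm
      · obtain ⟨u, rfl⟩ := Nat.exists_eq_add_of_le (not_lt.mp htm)
        have e1 := applyMorph_blockStart_add hσ x (a + L) u (by omega)
        have e2 := applyMorph_blockStart_add hσ x (b + L) u (by rw [← hx]; omega)
        rw [← Nat.add_assoc, ← Nat.add_assoc, ← h1, ← h2, e1, e2, hx]

lemma one_le_length_hm (c : Fin 3) : 1 ≤ (hm c).length := by
  fin_cases c <;> simp [hm]

lemma one_le_length_gm (c : Fin 3) : 1 ≤ (gm c).length := by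
  fin_cases c <;> simp [gm]

lemma fin_three_cases (c : Fin 3) : c = 0 ∨ c = 1 ∨ c = 2 := by
  fin_cases c <;> simp

/-- The number of occurrences of the letter `c` among the first `n` letters of `x`. -/
def prefixCount (x : ℕ → Fin 3) (c : Fin 3) : ℕ → ℤ
  | 0 => 0
  | n + 1 => prefixCount x c n + if x n = c then 1 else 0

lemma prefixCount_mono (x : ℕ → Fin 3) (c : Fin 3) : Monotone (prefixCount x c) :=
  monotone_nat_of_le_succ fun n => by
    simp only [prefixCount]
    split_ifs <;> omega

lemma prefixCount_sum (x : ℕ → Fin 3) (n : ℕ) :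
    prefixCount x 0 n + prefixCount x 1 n + prefixCount x 2 n = n := by
  induction n with
  | zero => simp [prefixCount]
  | succ n ih =>
    rcases fin_three_cases (x n) with h | h | h <;> simp [prefixCount, h] <;> omega

lemma blockStart_gm (x : ℕ → Fin 3) (n : ℕ) :
    (blockStart gm x n : ℤ) =
      3 * prefixCount x 0 n + prefixCount x 1 n + 2 * prefixCount x 2 n := by
  induction n with
  | zero => simp [prefixCount, blockStart]
  | succ n ih =>
    rcases fin_three_cases (x n) with h | h | h <;>
      simp [prefixCount, blockStart, h, ih, show (gm 0).length = 3 from rfl,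
        show (gm 1).length = 1 from rfl, show (gm 2).length = 2 from rfl] <;> ring

lemma gm_block_zero (x : ℕ → Fin 3) (k : ℕ) (h : x k = 0) :
    blockStart gm x (k + 1) = blockStart gm x k + 3 ∧
    applyMorph gm x (blockStart gm x k + 1) = 1 ∧ applyMorph gm x (blockStart gm x k + 2) = 1 := by
  refine ⟨by simp [blockStart, h, gm], ?_, ?_⟩ <;>
  · rw [applyMorph_blockStart_add one_le_length_gm _ _ _ (by simp [h, gm])]
    simp [h, gm]

lemma gm_block_one (x : ℕ → Fin 3) (k : ℕ) (h : x k = 1) :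
    blockStart gm x (k + 1) = blockStart gm x k + 1 := by
  simp [blockStart, h, gm]

lemma gm_block_two (x : ℕ → Fin 3) (k : ℕ) (h : x k = 2) :
    blockStart gm x (k + 1) = blockStart gm x k + 2 ∧
    applyMorph gm x (blockStart gm x k + 1) = 1 := by
  refine ⟨by simp [blockStart, h, gm], ?_⟩
  rw [applyMorph_blockStart_add one_le_length_gm _ _ _ (by simp [h, gm])]
  simp [h, gm]

lemma gm_block_first (x : ℕ → Fin 3) (k : ℕ) : applyMorph gm x (blockStart gm x k) = 0 := by
  have := applyMorph_blockStart_add one_le_length_gm x k 0 (one_le_length_gm _)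
  rw [Nat.add_zero] at this
  rw [this]
  rcases fin_three_cases (x k) with h | h | h <;> simp [h, gm]

lemma hm_block_zero {p : ℕ → Fin 3} (hp : applyMorph hm p = p) {k : ℕ} (h : p k = 0) :
    blockStart hm p (k + 1) = blockStart hm p k + 2 ∧
    p (blockStart hm p k) = 0 ∧ p (blockStart hm p k + 1) = 1 := by
  have h0 := applyMorph_blockStart_add one_le_length_hm p k 0 (by simp [h, hm])
  have h1 := applyMorph_blockStart_add one_le_length_hm p k 1 (by simp [h, hm])
  rw [hp] at h0 h1
  refine ⟨by simp [blockStart, h, hm], ?_, ?_⟩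
  · simpa [h, hm] using h0
  · simpa [h, hm] using h1

lemma hm_block_one {p : ℕ → Fin 3} (hp : applyMorph hm p = p) {k : ℕ} (h : p k = 1) :
    blockStart hm p (k + 1) = blockStart hm p k + 2 ∧
    p (blockStart hm p k) = 2 ∧ p (blockStart hm p k + 1) = 1 := by
  have h0 := applyMorph_blockStart_add one_le_length_hm p k 0 (by simp [h, hm])
  have h1 := applyMorph_blockStart_add one_le_length_hm p k 1 (by simp [h, hm])
  rw [hp] at h0 h1
  refine ⟨by simp [blockStart, h, hm], ?_, ?_⟩
  · simpa [h, hm] using h0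
  · simpa [h, hm] using h1

lemma hm_block_two {p : ℕ → Fin 3} (hp : applyMorph hm p = p) {k : ℕ} (h : p k = 2) :
    blockStart hm p (k + 1) = blockStart hm p k + 1 ∧ p (blockStart hm p k) = 0 := by
  have h0 := applyMorph_blockStart_add one_le_length_hm p k 0 (by simp [h, hm])
  rw [hp] at h0
  refine ⟨by simp [blockStart, h, hm], ?_⟩
  simpa [h, hm] using h0

lemma hm_block_first_ne_one {p : ℕ → Fin 3} (hp : applyMorph hm p = p) (k : ℕ) :
    p (blockStart hm p k) ≠ 1 := by
  rcases fin_three_cases (p k) with h | h | h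
  · simp [hm_block_zero hp h]
  · simp [hm_block_one hp h]
  · simp [hm_block_two hp h]

lemma prefixCount_blockStart {p : ℕ → Fin 3} (hp : applyMorph hm p = p) (k : ℕ) :
    prefixCount p 0 (blockStart hm p k) = prefixCount p 0 k + prefixCount p 2 k ∧
    prefixCount p 1 (blockStart hm p k) = prefixCount p 0 k + prefixCount p 1 k ∧
    prefixCount p 2 (blockStart hm p k) = prefixCount p 1 k := by
  induction k with
  | zero => simp [prefixCount, blockStart]
  | succ k ih =>
    obtain ⟨i0, i1, i2⟩ := ih
    rcases fin_three_cases (p k) with h | h | h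
    · obtain ⟨e, h0, h1⟩ := hm_block_zero hp h
      rw [e]
      simp [prefixCount, h, h0, h1, i0, i1, i2]
      omega
    · obtain ⟨e, h0, h1⟩ := hm_block_one hp h
      rw [e]
      simp [prefixCount, h, h0, h1, i0, i1, i2]
      omega
    · obtain ⟨e, h0⟩ := hm_block_two hp h
      rw [e]
      simp [prefixCount, h, h0, i0, i1, i2]
      omega

/-- Every position of the fixed point either starts a block, and carries `0` or `2`, or is
the second position of a block of length two, and carries `1`. -/
lemma block_position {p : ℕ → Fin 3} (hp : applyMorph hm p = p) (i : ℕ) :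
    (p i ≠ 1 ∧ ∃ k, i = blockStart hm p k) ∨
    (p i = 1 ∧ ∃ k, p k ≠ 2 ∧ i = blockStart hm p k + 1 ∧
      blockStart hm p (k + 1) = i + 1) := by
  obtain ⟨k, t, ht, rfl⟩ := exists_block one_le_length_hm p i
  obtain rfl | ht0 := Nat.eq_zero_or_pos t
  · exact Or.inl ⟨hm_block_first_ne_one hp k, k, rfl⟩
  · rcases fin_three_cases (p k) with h | h | h
    · obtain rfl : t = 1 := by simp [h, hm] at ht; omega
      obtain ⟨e, -, h1⟩ := hm_block_zero hp h
      exact Or.inr ⟨h1, k, by simp [h], rfl, by omega⟩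
    · obtain rfl : t = 1 := by simp [h, hm] at ht; omega
      obtain ⟨e, -, h1⟩ := hm_block_one hp h
      exact Or.inr ⟨h1, k, by simp [h], rfl, by omega⟩
    · simp [h, hm] at ht
      omega

lemma eq_one_of_prev_eq_two {p : ℕ → Fin 3} (hp : applyMorph hm p = p) {i : ℕ} (h : p i = 2) :
    p (i + 1) = 1 := by
  rcases block_position hp i with ⟨-, k, rfl⟩ | ⟨h1, -⟩
  · rcases fin_three_cases (p k) with hk | hk | hk
    · simp [hm_block_zero hp hk] at h
    · exact (hm_block_one hp hk).2.2
    · simp [hm_block_two hp hk] at h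
  · simp [h1] at h

/-- What stops a repetition from being extended to the left: the beginning of the word, or a
mismatch between the letters `0, 1`, between `0, 2`, or between `1, 2`. -/
inductive LeftStop
  | start
  | zeroOne
  | zeroTwo
  | oneTwo

/-- What stops a repetition from being extended to the right: a mismatch between `0, 2`, or
a mismatch involving `1`. -/
inductive RightStop
  | zeroTwo
  | withOne

/-- The left obstruction after applying `h`. -/
def LeftStop.next : LeftStop → LeftStop
  | start => start
  | zeroOne => zeroTwo
  | zeroTwo => zeroOne
  | oneTwo => zeroOne

/-- The right obstruction after applying `h`. -/
def RightStop.next : RightStop → RightStop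
  | zeroTwo => withOne
  | withOne => zeroTwo

/-- Five times the letter counts of the left part of the boundary correction. -/
def LeftStop.corr : LeftStop → Fin 3 → ℤ
  | start => ![0, 0, 0]
  | zeroOne => ![3, 1, -1]
  | zeroTwo => ![2, -1, 1]
  | oneTwo => ![2, -1, 1]

/-- Five times the letter counts of the right part of the boundary correction. -/
def RightStop.corr : RightStop → Fin 3 → ℤ
  | zeroTwo => ![1, 2, 3]
  | withOne => ![-1, 3, 2]

/-- The number of letters by which `g` extends a repetition to the left. -/
def LeftStop.ext : LeftStop → ℤ
  | zeroTwo => 1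
  | _ => 0

/-- The number of letters by which `g` extends a repetition to the right. -/
def RightStop.ext : RightStop → ℤ
  | zeroTwo => 2
  | withOne => 1

/-- The left obstruction given by two mismatching letters. -/
def leftStop (x y : Fin 3) : LeftStop :=
  if x ≠ 2 ∧ y ≠ 2 then .zeroOne else if x = 0 ∨ y = 0 then .zeroTwo else .oneTwo

/-- The left obstruction of the repetition given by the positions `i` and `j`. -/
def leftStopAt (p : ℕ → Fin 3) (i j : ℕ) : LeftStop :=
  if i = 0 then .start else leftStop (p (i - 1)) (p (j - 1))

/-- The right obstruction given by two mismatching letters. -/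
def rightStop (x y : Fin 3) : RightStop :=
  if x = 1 ∨ y = 1 then .withOne else .zeroTwo

/-- The slack vector `(x, y, z)` of a repetition, after `k` further applications of `h`, is large
enough for the image under `g` to have exponent at most `5 / 2`. -/
def SlackAfter : ℕ → LeftStop → RightStop → ℤ → ℤ → ℤ → Prop
  | 0, l, r, x, y, z =>
    10 * (l.ext + r.ext) - 2 * (3 * (l.corr 0 + r.corr 0) + (l.corr 1 + r.corr 1)
      + 2 * (l.corr 2 + r.corr 2)) ≤ 3 * x + y + 2 * z
  | k + 1, l, r, x, y, z => SlackAfter k l.next r.next (x + z) (x + y) y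

lemma slackAfter_of_pos (k : ℕ) (l : LeftStop) (r : RightStop) (x y z : ℤ)
    (hx : 1 ≤ x) (hy : 1 ≤ y) (hz : 0 ≤ z) : SlackAfter k l r x y z := by
  induction k generalizing l r x y z with
  | zero =>
    cases l <;> cases r <;>
      simp [SlackAfter, LeftStop.ext, RightStop.ext, LeftStop.corr, RightStop.corr] <;> omega
  | succ k ih => exact ih _ _ _ _ _ (by omega) (by omega) (by omega)

/-- The repetition of the blocks starting at `i` and `j` with common part of length `L` has
enough slack after any number of applications of `h`. -/
def HasSlack (p : ℕ → Fin 3) (i j L : ℕ) : Prop :=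
  ∀ k, SlackAfter k (leftStopAt p i j) (rightStop (p (i + L)) (p (j + L)))
    (15 * (prefixCount p 0 j - prefixCount p 0 i)
      - 10 * (prefixCount p 0 (i + L) - prefixCount p 0 i)
      - 2 * ((leftStopAt p i j).corr 0 + (rightStop (p (i + L)) (p (j + L))).corr 0))
    (15 * (prefixCount p 1 j - prefixCount p 1 i)
      - 10 * (prefixCount p 1 (i + L) - prefixCount p 1 i)
      - 2 * ((leftStopAt p i j).corr 1 + (rightStop (p (i + L)) (p (j + L))).corr 1))
    (15 * (prefixCount p 2 j - prefixCount p 2 i)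
      - 10 * (prefixCount p 2 (i + L) - prefixCount p 2 i)
      - 2 * ((leftStopAt p i j).corr 2 + (rightStop (p (i + L)) (p (j + L))).corr 2))


/-- The slack of a repetition with empty common part. -/
lemma slackAfter_base (k : ℕ) (l : LeftStop) (r : RightStop) (a b c : ℤ)
    (ha : 0 ≤ a) (hb : 0 ≤ b) (hc : 0 ≤ c)
    (h : 2 ≤ a + b + c ∨ (a = 1 ∧ b = 0 ∧ c = 0 ∧ l ≠ .oneTwo) ∨
      (a = 0 ∧ b = 1 ∧ c = 0 ∧ r = .withOne ∧ (l = .zeroOne ∨ l = .oneTwo)) ∨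
      (a = 0 ∧ b = 0 ∧ c = 1 ∧ r = .withOne ∧ (l = .zeroTwo ∨ l = .oneTwo))) :
    SlackAfter k l r (15 * a - 2 * (l.corr 0 + r.corr 0)) (15 * b - 2 * (l.corr 1 + r.corr 1))
      (15 * c - 2 * (l.corr 2 + r.corr 2)) := by
  rcases k with _ | _ | _ | _ | _ | _ | _ | k <;> cases l <;> cases r <;>
    simp [SlackAfter, LeftStop.ext, RightStop.ext, LeftStop.corr, RightStop.corr,
      LeftStop.next, RightStop.next] at h ⊢ <;>
    first
    | omega
    | (apply slackAfter_of_pos <;> omega)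

lemma lt_blockStart_hm {p : ℕ → Fin 3} (hp0 : p 0 = 0) {k : ℕ} (hk : 1 ≤ k) :
    k < blockStart hm p k := by
  induction k, hk using Nat.le_induction with
  | base => simp [blockStart, hp0, hm]
  | succ k _ ih =>
    have := one_le_length_hm (p k)
    simp only [blockStart]
    omega

/-- The image under `h` of a mismatch. -/
lemma exists_mismatch_blockStart {p : ℕ → Fin 3} (hp : applyMorph hm p = p) {u w : ℕ}
    (h : p u ≠ p w) :
    ∃ ρ, (∀ t < ρ, p (blockStart hm p u + t) = p (blockStart hm p w + t)) ∧
      p (blockStart hm p u + ρ) ≠ p (blockStart hm p w + ρ) ∧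
      rightStop (p (blockStart hm p u + ρ)) (p (blockStart hm p w + ρ)) =
        (rightStop (p u) (p w)).next ∧
      (ρ = 0 ∧ rightStop (p u) (p w) = .withOne ∨
        ρ = 1 ∧ rightStop (p u) (p w) = .zeroTwo ∧ p (blockStart hm p u) = 0) := by
  have hu := hm_block_first_ne_one hp (u + 1)
  have hw := hm_block_first_ne_one hp (w + 1)
  rcases fin_three_cases (p u) with h1 | h1 | h1 <;>
  rcases fin_three_cases (p w) with h2 | h2 | h2
  · simp [h1, h2] at h
  · have a1 := hm_block_zero hp h1
    have a2 := hm_block_one hp h2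
    exact ⟨0, by simp, by simp [a1, a2], by simp [a1, a2, h1, h2, rightStop, RightStop.next],
      by simp [h1, h2, rightStop]⟩
  · have a1 := hm_block_zero hp h1
    have a2 := hm_block_two hp h2
    rw [a2.1] at hw
    refine ⟨1, by simp [a1, a2], ?_, by simp [a1, h1, h2, rightStop, RightStop.next],
      by simp [h1, h2, rightStop, a1]⟩
    rw [a1.2.2]
    exact hw.symm
  · have a1 := hm_block_one hp h1
    have a2 := hm_block_zero hp h2
    exact ⟨0, by simp, by simp [a1, a2], by simp [a1, a2, h1, h2, rightStop, RightStop.next],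
      by simp [h1, h2, rightStop]⟩
  · simp [h1, h2] at h
  · have a1 := hm_block_one hp h1
    have a2 := hm_block_two hp h2
    exact ⟨0, by simp, by simp [a1, a2], by simp [a1, a2, h1, h2, rightStop, RightStop.next],
      by simp [h1, h2, rightStop]⟩
  · have a1 := hm_block_two hp h1
    have a2 := hm_block_zero hp h2
    rw [a1.1] at hu
    refine ⟨1, by simp [a1, a2], ?_, by simp [a2, h1, h2, rightStop, RightStop.next],
      by simp [h1, h2, rightStop, a1]⟩
    rw [a2.2.2]
    exact hu
  · have a1 := hm_block_two hp h1
    have a2 := hm_block_one hp h2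
    exact ⟨0, by simp, by simp [a1, a2], by simp [a1, a2, h1, h2, rightStop, RightStop.next],
      by simp [h1, h2, rightStop]⟩
  · simp [h1, h2] at h

/-- The last letter of a block of the fixed point. -/
lemma hm_block_last {p : ℕ → Fin 3} (hp : applyMorph hm p = p) (k : ℕ) :
    p (blockStart hm p (k + 1) - 1) = if p k = 2 then 0 else 1 := by
  rcases fin_three_cases (p k) with h | h | h
  · obtain ⟨e, -, h1⟩ := hm_block_zero hp h
    simp [e, h, h1]
  · obtain ⟨e, -, h1⟩ := hm_block_one hp h
    simp [e, h, h1]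
  · obtain ⟨e, h1⟩ := hm_block_two hp h
    simp [e, h, h1]

/-- A left-maximal repetition with nonempty common part comes, up to one letter, from a
left-maximal repetition of blocks. -/
lemma exists_block_alignment {p : ℕ → Fin 3} (hp0 : p 0 = 0) (hp : applyMorph hm p = p) {i j : ℕ}
    (hij : i < j) (heq : p i = p j) (hmax : i = 0 ∨ p (i - 1) ≠ p (j - 1)) :
    ∃ a b ε, a < b ∧ b < j ∧ i + ε = blockStart hm p a ∧ j + ε = blockStart hm p b ∧
      (a = 0 ∨ p (a - 1) ≠ p (b - 1)) ∧ leftStopAt p i j = (leftStopAt p a b).next ∧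
      (ε = 0 ∧ leftStopAt p a b ≠ .zeroOne ∨
        ε = 1 ∧ leftStopAt p a b = .zeroOne ∧ p i = 1) := by
  have hmono := blockStart_strictMono one_le_length_hm p
  rcases block_position hp i with ⟨hi, a, rfl⟩ | ⟨hi, a, ha2, hia, hea⟩
  · rcases block_position hp j with ⟨-, b, rfl⟩ | ⟨hj, -⟩
    swap
    · exact absurd (heq.trans hj) hi
    have hab : a < b := hmono.lt_iff_lt.mp hij
    have hb := lt_blockStart_hm hp0 (show 1 ≤ b by omega)
    obtain rfl | ha := Nat.eq_zero_or_pos a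
    · refine ⟨0, b, 0, hab, hb, rfl, rfl, Or.inl rfl, ?_, Or.inl ⟨rfl, ?_⟩⟩ <;>
        simp [leftStopAt, blockStart, LeftStop.next]
    · obtain ⟨a, rfl⟩ := Nat.exists_eq_add_of_le' (show 1 ≤ a from ha)
      obtain ⟨b, rfl⟩ := Nat.exists_eq_add_of_le' (show 1 ≤ b by omega)
      have hne : blockStart hm p (a + 1) ≠ 0 := by
        have := lt_blockStart_hm hp0 ha
        omega
      have hmax := hmax.resolve_left hne
      have hl : leftStopAt p (blockStart hm p (a + 1)) (blockStart hm p (b + 1)) =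
          leftStop (if p a = 2 then 0 else 1) (if p b = 2 then 0 else 1) := by
        rw [leftStopAt, if_neg hne, hm_block_last hp, hm_block_last hp]
      rw [hm_block_last hp, hm_block_last hp] at hmax
      refine ⟨a + 1, b + 1, 0, hab, hb, rfl, rfl, Or.inr ?_, ?_, Or.inl ⟨rfl, ?_⟩⟩
      · rw [Nat.add_sub_cancel, Nat.add_sub_cancel]
        intro h
        rw [h] at hmax
        exact hmax rfl
      · rw [hl, leftStopAt, if_neg (Nat.succ_ne_zero a), Nat.add_sub_cancel, Nat.add_sub_cancel]
        revert hmax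
        generalize p a = x
        generalize p b = y
        fin_cases x <;> fin_cases y <;> simp [leftStop, LeftStop.next]
      · rw [leftStopAt, if_neg (by omega), Nat.add_sub_cancel, Nat.add_sub_cancel]
        revert hmax
        generalize p a = x
        generalize p b = y
        fin_cases x <;> fin_cases y <;> simp [leftStop]
  · rcases block_position hp j with ⟨hj, -⟩ | ⟨-, b, hb2, hjb, heb⟩
    · exact absurd (heq.symm.trans hi) hj
    have hab : a < b := hmono.lt_iff_lt.mp (by omega)
    have hb := lt_blockStart_hm hp0 (show 1 ≤ b by omega)
    have hmax := hmax.resolve_left (by omega)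
    have hi1 : i - 1 = blockStart hm p a := by omega
    have hj1 : j - 1 = blockStart hm p b := by omega
    rw [hi1, hj1] at hmax
    have hl : leftStopAt p (a + 1) (b + 1) = .zeroOne := by
      simp [leftStopAt, leftStop, ha2, hb2]
    have fa : p (blockStart hm p a) = if p a = 0 then 0 else 2 := by
      rcases fin_three_cases (p a) with h | h | h
      · simp [hm_block_zero hp h, h]
      · simp [hm_block_one hp h, h]
      · exact absurd h ha2
    have fb : p (blockStart hm p b) = if p b = 0 then 0 else 2 := by
      rcases fin_three_cases (p b) with h | h | h
      · simp [hm_block_zero hp h, h]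
      · simp [hm_block_one hp h, h]
      · exact absurd h hb2
    refine ⟨a + 1, b + 1, 1, by omega, by omega, hea.symm, heb.symm, Or.inr ?_, ?_,
      Or.inr ⟨rfl, hl, hi⟩⟩
    · rw [Nat.add_sub_cancel, Nat.add_sub_cancel]
      intro h
      rw [fa, fb, h] at hmax
      exact hmax rfl
    · rw [hl, leftStopAt, if_neg (by omega), hi1, hj1, fa, fb]
      rw [fa, fb] at hmax
      split_ifs at hmax ⊢ <;> simp_all [leftStop, LeftStop.next]

/-- A left-maximal repetition with empty common part has slack. -/
lemma hasSlack_zero {p : ℕ → Fin 3} (hp0 : p 0 = 0) (hp : applyMorph hm p = p) {i j : ℕ}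
    (hij : i < j) (hne : p i ≠ p j) (hmax : i = 0 ∨ p (i - 1) ≠ p (j - 1)) :
    HasSlack p i j 0 := by
  intro k
  have m0 := prefixCount_mono p 0 hij.le
  have m1 := prefixCount_mono p 1 hij.le
  have m2 := prefixCount_mono p 2 hij.le
  have si := prefixCount_sum p i
  have sj := prefixCount_sum p j
  simp only [Nat.add_zero, sub_self, mul_zero, sub_zero]
  refine slackAfter_base k _ _ _ _ _ (by omega) (by omega) (by omega) ?_
  by_cases h2 : i + 2 ≤ j
  · left
    omega
  · right
    obtain rfl : j = i + 1 := by omega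
    rw [Nat.add_sub_cancel] at hmax
    have h21 := @eq_one_of_prev_eq_two p hp i
    have hl : leftStopAt p i (i + 1) = if i = 0 then .start else leftStop (p (i - 1)) (p i) := by
      simp [leftStopAt]
    rw [hl]
    rcases hmax with rfl | hmax
    · simp [prefixCount, hp0]
    · by_cases hi : i = 0
      · subst hi
        simp [prefixCount, hp0]
      rw [if_neg hi]
      simp only [prefixCount, add_sub_cancel_left]
      revert hmax hne h21
      generalize p i = x
      generalize p (i - 1) = y
      generalize p (i + 1) = z
      revert x y z
      simp only [leftStop, rightStop]
      intro x y z
      fin_cases x <;> fin_cases y <;> fin_cases z <;> simp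

/-- Every left-maximal repetition of the fixed point is finite and has slack. -/
lemma exists_hasSlack {p : ℕ → Fin 3} (hp0 : p 0 = 0) (hp : applyMorph hm p = p) (j : ℕ) :
    ∀ i < j, (i = 0 ∨ p (i - 1) ≠ p (j - 1)) →
      ∃ L, (∀ t < L, p (i + t) = p (j + t)) ∧ p (i + L) ≠ p (j + L) ∧ HasSlack p i j L := by
  induction j using Nat.strong_induction_on with
  | _ j ih =>
    intro i hij hmax
    by_cases heq : p i = p j
    swap
    · exact ⟨0, by simp, heq, hasSlack_zero hp0 hp hij heq hmax⟩
    obtain ⟨a, b, ε, hab, hbj, ha, hb, hmax', hl, hε⟩ :=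
      exists_block_alignment hp0 hp hij heq hmax
    obtain ⟨L, hL, hne, hs⟩ := ih b hbj a hab hmax'
    obtain ⟨m, hma, hmb, hmm⟩ := applyMorph_eq_of_match one_le_length_hm p a b L hL
    obtain ⟨ρ, hρm, hρne, hr, hρ⟩ := exists_mismatch_blockStart hp hne
    rw [hp, ← ha, ← hb] at hmm
    have ea : i + (ε + m + ρ) = blockStart hm p (a + L) + ρ := by omega
    have eb : j + (ε + m + ρ) = blockStart hm p (b + L) + ρ := by omega
    refine ⟨ε + m + ρ, ?_, ?_, ?_⟩
    · intro t ht
      by_cases h1 : t < ε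
      · obtain rfl : t = 0 := by omega
        exact heq
      by_cases h2 : t < ε + m
      · have := hmm (t - ε) (by omega)
        rwa [show i + ε + (t - ε) = i + t by omega, show j + ε + (t - ε) = j + t by omega] at this
      · have := hρm (t - ε - m) (by omega)
        rwa [show blockStart hm p (a + L) + (t - ε - m) = i + t by omega,
          show blockStart hm p (b + L) + (t - ε - m) = j + t by omega] at this
    · rw [ea, eb]
      exact hρne
    · intro k
      have hk := hs (k + 1)
      rw [ea, eb, hl, hr]
      have cL := prefixCount_blockStart hp (a + L)
      have ca := prefixCount_blockStart hp a
      have cb := prefixCount_blockStart hp b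
      have hεp : (∀ c, prefixCount p c (blockStart hm p a) = prefixCount p c i +
          if c = 1 then (ε : ℤ) else 0) ∧ (∀ c, prefixCount p c (blockStart hm p b) =
          prefixCount p c j + if c = 1 then (ε : ℤ) else 0) := by
        rw [← ha, ← hb]
        rcases hε with ⟨rfl, -⟩ | ⟨rfl, -, h1⟩
        · simp
        · have h1' := heq ▸ h1
          simp [prefixCount, h1, h1', eq_comm]
      have hρp : ∀ c, prefixCount p c (blockStart hm p (a + L) + ρ) =
          prefixCount p c (blockStart hm p (a + L)) + if c = 0 then (ρ : ℤ) else 0 := by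
        rcases hρ with ⟨rfl, -⟩ | ⟨rfl, -, h1⟩
        · simp
        · simp [prefixCount, h1, eq_comm]
      have a0 := hεp.1 0
      have a1 := hεp.1 1
      have a2 := hεp.1 2
      have b0 := hεp.2 0
      have b1 := hεp.2 1
      have b2 := hεp.2 2
      have r0 := hρp 0
      have r1 := hρp 1
      have r2 := hρp 2
      simp at a0 a1 a2 b0 b1 b2 r0 r1 r2
      simp only [SlackAfter] at hk
      generalize leftStopAt p a b = l at *
      generalize rightStop (p (a + L)) (p (b + L)) = r at *
      have hlc : l.next.corr 0 = l.corr 0 + l.corr 2 ∧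
          l.next.corr 1 = l.corr 0 + l.corr 1 - 5 * ε ∧ l.next.corr 2 = l.corr 1 := by
        rcases hε with ⟨rfl, h⟩ | ⟨rfl, h, -⟩ <;> cases l <;>
          simp [LeftStop.next, LeftStop.corr] at h ⊢
      have hrc : r.next.corr 0 = r.corr 0 + r.corr 2 - 5 * ρ ∧
          r.next.corr 1 = r.corr 0 + r.corr 1 ∧ r.next.corr 2 = r.corr 1 := by
        rcases hρ with ⟨rfl, h⟩ | ⟨rfl, h, -⟩ <;> cases r <;>
          simp [RightStop.next, RightStop.corr] at h ⊢
      convert hk using 1 <;> omega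

/-- The image under `g` of a mismatch. -/
lemma exists_mismatch_gm {p : ℕ → Fin 3} {u w : ℕ} (h : p u ≠ p w) :
    ∃ ρ : ℕ, (ρ : ℤ) = (rightStop (p u) (p w)).ext ∧
      applyMorph gm p (blockStart gm p u + ρ) ≠ applyMorph gm p (blockStart gm p w + ρ) := by
  have fu := gm_block_first p (u + 1)
  have fw := gm_block_first p (w + 1)
  rcases fin_three_cases (p u) with h1 | h1 | h1 <;>
  rcases fin_three_cases (p w) with h2 | h2 | h2
  · simp [h1, h2] at h
  · rw [gm_block_one _ _ h2] at fw
    exact ⟨1, by simp [h1, h2, rightStop, RightStop.ext], by simp [gm_block_zero _ _ h1, fw]⟩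
  · rw [(gm_block_two _ _ h2).1] at fw
    exact ⟨2, by simp [h1, h2, rightStop, RightStop.ext], by simp [gm_block_zero _ _ h1, fw]⟩
  · rw [gm_block_one _ _ h1] at fu
    exact ⟨1, by simp [h1, h2, rightStop, RightStop.ext], by simp [gm_block_zero _ _ h2, fu]⟩
  · simp [h1, h2] at h
  · rw [gm_block_one _ _ h1] at fu
    exact ⟨1, by simp [h1, h2, rightStop, RightStop.ext], by simp [gm_block_two _ _ h2, fu]⟩
  · rw [(gm_block_two _ _ h1).1] at fu
    exact ⟨2, by simp [h1, h2, rightStop, RightStop.ext], by simp [gm_block_zero _ _ h2, fu]⟩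
  · rw [gm_block_one _ _ h2] at fw
    exact ⟨1, by simp [h1, h2, rightStop, RightStop.ext], by simp [gm_block_two _ _ h1, fw]⟩
  · simp [h1, h2] at h

/-- The positions of the word `g(x)`: block starts, the second letter of a block, or the
third letter of a block. -/
lemma gm_position (x : ℕ → Fin 3) (i : ℕ) :
    (applyMorph gm x i = 0 ∧ ∃ k, i = blockStart gm x k) ∨
    (applyMorph gm x i = 1 ∧ ∃ k, x k = 0 ∧ i = blockStart gm x k + 1) ∨
    (applyMorph gm x i = 1 ∧ ∃ k, x k = 2 ∧ i = blockStart gm x k + 1) ∨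
    (applyMorph gm x i = 1 ∧ ∃ k, x k = 0 ∧ i = blockStart gm x k + 2) := by
  obtain ⟨k, t, ht, rfl⟩ := exists_block one_le_length_gm x i
  obtain rfl | ht0 := Nat.eq_zero_or_pos t
  · exact Or.inl ⟨gm_block_first x k, k, rfl⟩
  · right
    rcases fin_three_cases (x k) with h | h | h
    · obtain ⟨-, h1, h2⟩ := gm_block_zero x k h
      obtain rfl | rfl : t = 1 ∨ t = 2 := by simp [h, gm] at ht; omega
      · exact Or.inl ⟨h1, k, h, rfl⟩
      · exact Or.inr (Or.inr ⟨h2, k, h, rfl⟩)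
    · simp [h, gm] at ht
      omega
    · obtain rfl : t = 1 := by simp [h, gm] at ht; omega
      exact Or.inr (Or.inl ⟨(gm_block_two x k h).2, k, h, rfl⟩)

lemma gm_block_last (x : ℕ → Fin 3) (k : ℕ) :
    applyMorph gm x (blockStart gm x (k + 1) - 1) = if x k = 1 then 0 else 1 := by
  rcases fin_three_cases (x k) with h | h | h
  · simp [gm_block_zero x k h, h]
  · simp [gm_block_one x k h, h, gm_block_first]
  · simp [gm_block_two x k h, h]

/-- A left-maximal repetition of `g(x)` with at least two common letters comes, up to one
letter, from a left-maximal repetition of blocks. -/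
lemma exists_gm_alignment (x : ℕ → Fin 3) {i j : ℕ} (hij : i < j)
    (heq : applyMorph gm x i = applyMorph gm x j)
    (heq' : applyMorph gm x (i + 1) = applyMorph gm x (j + 1))
    (hmax : i = 0 ∨ applyMorph gm x (i - 1) ≠ applyMorph gm x (j - 1)) :
    ∃ a b ε, a < b ∧ i + ε = blockStart gm x a ∧ j + ε = blockStart gm x b ∧
      (a = 0 ∨ x (a - 1) ≠ x (b - 1)) ∧ (ε : ℤ) = (leftStopAt x a b).ext := by
  have hmono := blockStart_strictMono one_le_length_gm x
  have hthird : ∀ k l, x k = 0 → x l = 0 →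
      applyMorph gm x (blockStart gm x k + 2) ≠ applyMorph gm x (blockStart gm x l + 2 + 1) := by
    intro k l hk hl
    have := gm_block_first x (l + 1)
    rw [(gm_block_zero x l hl).1] at this
    rw [(gm_block_zero x k hk).2.2, this]
    decide
  rcases gm_position x i with ⟨hi, a, rfl⟩ | ⟨hi, a, hxa, rfl⟩ | ⟨hi, a, hxa, rfl⟩ |
      ⟨hi, a, hxa, rfl⟩ <;>
    rcases gm_position x j with ⟨hj, b, rfl⟩ | ⟨hj, b, hxb, rfl⟩ | ⟨hj, b, hxb, rfl⟩ |
      ⟨hj, b, hxb, rfl⟩ <;>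
    first
    | (rw [hi, hj] at heq; exact absurd heq (by decide))
    | (simp [gm_block_first, gm_block_zero, *] at hmax; done)
    | skip
  · have hab : a < b := hmono.lt_iff_lt.mp hij
    obtain rfl | ha := Nat.eq_zero_or_pos a
    · exact ⟨0, b, 0, hab, rfl, rfl, Or.inl rfl, by simp [leftStopAt, LeftStop.ext]⟩
    · obtain ⟨a, rfl⟩ := Nat.exists_eq_add_of_le' (show 1 ≤ a from ha)
      obtain ⟨b, rfl⟩ := Nat.exists_eq_add_of_le' (show 1 ≤ b by omega)
      have hpos := le_blockStart one_le_length_gm x (a + 1)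
      have hmax := hmax.resolve_left (by omega)
      rw [gm_block_last, gm_block_last] at hmax
      refine ⟨a + 1, b + 1, 0, hab, rfl, rfl, Or.inr ?_, ?_⟩
      · rw [Nat.add_sub_cancel, Nat.add_sub_cancel]
        intro h
        rw [h] at hmax
        exact hmax rfl
      · rw [leftStopAt, if_neg (by omega), Nat.add_sub_cancel, Nat.add_sub_cancel]
        revert hmax
        generalize x a = y
        generalize x b = z
        fin_cases y <;> fin_cases z <;> simp [leftStop, LeftStop.ext]
  · exact absurd heq' (hthird a b hxa hxb)
  · have e1 := (gm_block_two x a hxa).1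
    have e2 := (gm_block_zero x b hxb).1
    refine ⟨a + 1, b + 1, 1, ?_, by omega, by omega, Or.inr ?_, ?_⟩
    · exact hmono.lt_iff_lt.mp (by omega)
    · simp [hxa, hxb]
    · simp [leftStopAt, hxa, hxb, leftStop, LeftStop.ext]
  · exact absurd heq'.symm (hthird b a hxb hxa)
  · have e1 := (gm_block_zero x a hxa).1
    have e2 := (gm_block_two x b hxb).1
    refine ⟨a + 1, b + 1, 1, ?_, by omega, by omega, Or.inr ?_, ?_⟩
    · exact hmono.lt_iff_lt.mp (by omega)
    · simp [hxa, hxb]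
    · simp [leftStopAt, hxa, hxb, leftStop, LeftStop.ext]

/-- Every repetition extends to the left to a left-maximal one. -/
lemma exists_leftMaximal {A : Type*} (y : ℕ → A) (n L i : ℕ)
    (hm : ∀ t < L, y (i + t) = y (i + n + t)) :
    ∃ i' L', L ≤ L' ∧ (∀ t < L', y (i' + t) = y (i' + n + t)) ∧
      (i' = 0 ∨ y (i' - 1) ≠ y (i' + n - 1)) := by
  induction i generalizing L with
  | zero => exact ⟨0, L, le_rfl, hm, Or.inl rfl⟩
  | succ i ih =>
    by_cases h : y i = y (i + n)
    · obtain ⟨i', L', hL, h1, h2⟩ := ih (L + 1) fun t ht => by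
        obtain rfl | ht0 := Nat.eq_zero_or_pos t
        · exact h
        · obtain ⟨t, rfl⟩ := Nat.exists_eq_add_of_le' ht0
          have := hm t (by omega)
          rwa [show i + 1 + t = i + (t + 1) by omega,
            show i + 1 + n + t = i + n + (t + 1) by omega] at this
      exact ⟨i', L', by omega, h1, h2⟩
    · refine ⟨i + 1, L, le_rfl, hm, Or.inr ?_⟩
      rwa [show i + 1 + n - 1 = i + n by omega, Nat.add_sub_cancel]

/-- In `g(p)`, the common part of a repetition of period `n` has length at most `3n/2`. -/
lemma two_mul_le_of_match {p : ℕ → Fin 3} (hp0 : p 0 = 0) (hp : applyMorph hm p = p) {i n L : ℕ}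
    (hn : 1 ≤ n) (hL : ∀ t < L, applyMorph gm p (i + t) = applyMorph gm p (i + n + t)) :
    2 * L ≤ 3 * n := by
  by_contra! hlt
  obtain ⟨i, L', hLL, hm', hmax⟩ := exists_leftMaximal _ n L i hL
  obtain ⟨a, b, ε, hab, ha, hb, hmax', hε⟩ := exists_gm_alignment p (show i < i + n by omega)
    (hm' 0 (by omega)) (hm' 1 (by omega)) hmax
  obtain ⟨K, hK, hne, hs⟩ := exists_hasSlack hp0 hp b a hab hmax'
  obtain ⟨m, hma, hmb, -⟩ := applyMorph_eq_of_match one_le_length_gm p a b K hK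
  obtain ⟨ρ, hρ, hρne⟩ := exists_mismatch_gm hne
  have hle : L' ≤ ε + m + ρ := by
    by_contra! h
    have := hm' _ h
    rw [show i + (ε + m + ρ) = blockStart gm p (a + K) + ρ by omega,
      show i + n + (ε + m + ρ) = blockStart gm p (b + K) + ρ by omega] at this
    exact hρne this
  have h0 := hs 0
  simp only [SlackAfter, ← hε, ← hρ] at h0
  have ca := blockStart_gm p a
  have cb := blockStart_gm p b
  have cK := blockStart_gm p (a + K)
  omega

/-- The word `q = g(p)` is `(5/2)⁺`-power-free: no nonempty factor has exponent `> 5/2`;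
equivalently, there are no `i ≥ 0`, `n ≥ 1` with `q[t] = q[t+n]` for all
`i ≤ t ≤ i + 3n/2`. -/
theorem stmt3 (p : ℕ → Fin 3) (hp0 : p 0 = 0) (hpfix : applyMorph hm p = p) :
    (∀ w : List (Fin 2), IsFactor (applyMorph gm p) w → w ≠ [] → exponent w ≤ 5 / 2) ∧
    ¬ ∃ i n : ℕ, 1 ≤ n ∧ ∀ t, i ≤ t → 2 * t ≤ 2 * i + 3 * n →
        applyMorph gm p t = applyMorph gm p (t + n) := by
  have hq : ∀ i n : ℕ, 1 ≤ n → ¬ ∀ t, i ≤ t → 2 * t ≤ 2 * i + 3 * n →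
      applyMorph gm p t = applyMorph gm p (t + n) := by
    intro i n hn h
    have := two_mul_le_of_match hp0 hpfix (i := i) (L := 3 * n / 2 + 1) hn fun t ht => by
      rw [h (i + t) (by omega) (by omega), Nat.add_right_comm]
    omega
  refine ⟨?_, fun ⟨i, n, hn, h⟩ => hq i n hn h⟩
  rintro w ⟨i, hw⟩ hne
  have hlen : 1 ≤ w.length := List.length_pos_iff.mpr hne
  obtain ⟨h1, -, h3⟩ : HasPeriod w (minPeriod w) :=
    Nat.sInf_mem (s := {p | HasPeriod w p}) ⟨w.length, hlen, le_rfl, fun j hj => by omega⟩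
  have hget : ∀ j < w.length, w.getD j default = applyMorph gm p (i + j) := by
    intro j hj
    rw [hw]
    simp [FactorAt, hj]
  rw [exponent, div_le_iff₀ (by exact_mod_cast h1)]
  by_contra! hlt
  have hlt' : 5 * minPeriod w < 2 * w.length := by
    have : (5 : ℚ) * minPeriod w < 2 * w.length := by linarith
    exact_mod_cast this
  refine hq i (minPeriod w) h1 fun t ht ht' => ?_
  obtain ⟨j, rfl⟩ := Nat.exists_eq_add_of_le ht
  have := h3 j (by omega)
  rwa [hget _ (by omega), hget _ (by omega), ← Nat.add_assoc] at this
end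

section
/- The infinite binary word q = g(p) has factor complexity exactly 2n for all n ≥ 1: for every n ≥ 1, the number of distinct factors of q of length n is 2n. -/
namespace InfiniteWord

variable {A : Type*}

/-- The infinite word `a x₀ x₁ ⋯`. -/
def cons (a : A) (x : ℕ → A) : ℕ → A
  | 0 => a
  | n + 1 => x n

@[simp] lemma cons_zero (a : A) (x : ℕ → A) : cons a x 0 = a := rfl

@[simp] lemma cons_succ (a : A) (x : ℕ → A) (n : ℕ) : cons a x (n + 1) = x n := rfl

lemma exists_eq_cons (x : ℕ → A) : ∃ a y, x = cons a y :=
  ⟨x 0, fun n => x (n + 1), by funext n; cases n <;> rfl⟩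

@[simp] lemma cons_inj {a b : A} {x y : ℕ → A} : cons a x = cons b y ↔ a = b ∧ x = y := by
  refine ⟨fun h => ⟨congrFun h 0, funext fun n => congrFun h (n + 1)⟩, ?_⟩
  rintro ⟨rfl, rfl⟩
  rfl

/-- Two infinite words have the same prefix of length `n`. -/
def Agree (x y : ℕ → A) (n : ℕ) : Prop := ∀ t < n, x t = y t

@[simp] lemma agree_zero (x y : ℕ → A) : Agree x y 0 := fun _ h => absurd h (Nat.not_lt_zero _)

lemma agree_refl (x : ℕ → A) (n : ℕ) : Agree x x n := fun _ _ => rfl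

lemma Agree.symm {x y : ℕ → A} {n : ℕ} (h : Agree x y n) : Agree y x n :=
  fun t ht => (h t ht).symm

lemma Agree.trans {x y z : ℕ → A} {n : ℕ} (h : Agree x y n) (h' : Agree y z n) : Agree x z n :=
  fun t ht => (h t ht).trans (h' t ht)

lemma Agree.mono {x y : ℕ → A} {m n : ℕ} (h : Agree x y n) (hmn : m ≤ n) : Agree x y m :=
  fun t ht => h t (ht.trans_le hmn)

lemma Agree.le_of_ne {x y : ℕ → A} {k n : ℕ} (h : Agree x y n) (hk : x k ≠ y k) : n ≤ k :=
  not_lt.1 fun hlt => hk (h k hlt)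

@[simp] lemma agree_cons {a b : A} {x y : ℕ → A} {n : ℕ} :
    Agree (cons a x) (cons b y) (n + 1) ↔ a = b ∧ Agree x y n := by
  refine ⟨fun h => ⟨h 0 n.succ_pos, fun t ht => h (t + 1) (Nat.succ_lt_succ ht)⟩, ?_⟩
  rintro ⟨rfl, h⟩ (_ | t) ht
  · rfl
  · exact h t (Nat.lt_of_succ_lt_succ ht)

lemma agree_or_exists_ne (x y : ℕ → A) (n : ℕ) :
    Agree x y n ∨ ∃ m < n, Agree x y m ∧ x m ≠ y m := by
  classical
  by_cases h : Agree x y n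
  · exact Or.inl h
  · have hex : ∃ t, t < n ∧ x t ≠ y t := by simpa [Agree] using h
    refine Or.inr ⟨Nat.find hex, (Nat.find_spec hex).1, fun t ht => ?_, (Nat.find_spec hex).2⟩
    by_contra hne
    exact Nat.find_min hex ht ⟨ht.trans (Nat.find_spec hex).1, hne⟩

/-- A map on infinite words that always lengthens common prefixes has a fixed point. -/
lemma exists_fixed_of_agree_succ [Inhabited A] (F : (ℕ → A) → ℕ → A)
    (hF : ∀ x y n, Agree x y n → Agree (F x) (F y) (n + 1)) : ∃ x, F x = x := by
  have key : ∀ n k x, Agree (F^[n] x) (F^[n + k] x) n := by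
    intro n
    induction n with
    | zero => intros; simp
    | succ n ih =>
      intro k x
      rw [Nat.succ_add, Function.iterate_succ_apply', Function.iterate_succ_apply']
      exact hF _ _ _ (ih k x)
  let z : ℕ → A := fun _ => default
  let x : ℕ → A := fun n => F^[n + 1] z n
  have hx : ∀ n, Agree (F^[n] z) x n := by
    intro n t ht
    obtain ⟨k, rfl⟩ := Nat.exists_eq_add_of_lt ht
    have := key (t + 1) k z t t.lt_succ_self
    rw [Nat.add_right_comm] at this
    exact this.symm
  refine ⟨x, funext fun n => ?_⟩
  have := hF _ _ _ (hx n) n n.lt_succ_self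
  rw [← Function.iterate_succ_apply' F n z] at this
  exact this.symm

/-- `x` is a suffix of the infinite word `p`. -/
def IsSuffix (p x : ℕ → A) : Prop := ∃ i, x = fun t => p (i + t)

lemma isSuffix_refl (p : ℕ → A) : IsSuffix p p := ⟨0, by simp⟩

lemma IsSuffix.of_cons {p x : ℕ → A} {a : A} (h : IsSuffix p (cons a x)) : IsSuffix p x := by
  obtain ⟨i, hi⟩ := h
  refine ⟨i + 1, funext fun t => ?_⟩
  rw [← cons_succ a x t, hi]
  exact congrArg p (by omega)

lemma IsSuffix.shift {p x : ℕ → A} (h : IsSuffix p x) (k : ℕ) :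
    IsSuffix p fun t => x (k + t) := by
  obtain ⟨i, rfl⟩ := h
  exact ⟨i + k, by funext t; simp [add_assoc]⟩

/-- A property of infinite words that holds for `p` and passes to the word with the first letter
removed holds for all suffixes of `p`. -/
lemma IsSuffix.induction {p x : ℕ → A} (h : IsSuffix p x) {P : (ℕ → A) → Prop} (h0 : P p)
    (hs : ∀ a y, IsSuffix p (cons a y) → P (cons a y) → P y) : P x := by
  obtain ⟨i, rfl⟩ := h
  induction i with
  | zero => simpa using h0
  | succ i ih =>
    have e : (fun t => p (i + t)) = cons (p i) fun t => p (i + 1 + t) := by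
      funext t
      cases t with
      | zero => rfl
      | succ t => simp only [cons_succ]; congr 1; omega
    rw [e] at ih
    exact hs _ _ ⟨i, e.symm⟩ ih

section Morphism

variable {k : ℕ} {σ : Fin k → List A}

lemma length_flatten_range_ge (hσ : ∀ c, σ c ≠ []) (x : ℕ → Fin k) (m : ℕ) :
    m ≤ ((List.range m).map fun i => σ (x i)).flatten.length := by
  induction m with
  | zero => simp
  | succ m ih =>
    have := List.length_pos_iff.2 (hσ (x m))
    simp only [List.range_succ, List.map_append, List.flatten_append, List.length_append,
      List.map_cons, List.map_nil, List.flatten_cons, List.flatten_nil, List.append_nil]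
    omega

lemma IsSuffix.of_foldr_cons {p x : ℕ → A} {l : List A} (h : IsSuffix p (l.foldr cons x)) :
    IsSuffix p x := by
  induction l with
  | nil => exact h
  | cons a l ih => exact ih h.of_cons

variable [Inhabited A]

lemma getD_flatten_range (hσ : ∀ c, σ c ≠ []) (x : ℕ → Fin k) {n m : ℕ} (h : n < m) :
    ((List.range m).map fun i => σ (x i)).flatten.getD n default = applyMorph σ x n := by
  obtain ⟨d, rfl⟩ := Nat.exists_eq_add_of_lt h
  have hl := length_flatten_range_ge hσ x (n + 1)
  rw [show n + d + 1 = n + 1 + d by omega, List.range_add, List.map_append, List.flatten_append,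
    List.getD_append _ _ _ _ (by omega)]
  rfl

lemma applyMorph_cons (hσ : ∀ c, σ c ≠ []) (a : Fin k) (x : ℕ → Fin k) :
    applyMorph σ (cons a x) = (σ a).foldr cons (applyMorph σ x) := by
  have hfold : ∀ (l : List A) (y : ℕ → A) n,
      l.foldr cons y n = if n < l.length then l.getD n default else y (n - l.length) := by
    intro l y
    induction l with
    | nil => simp
    | cons b l ih =>
      rintro (_ | n)
      · simp
      · simp [ih]
  funext n
  rw [hfold]
  have hpos := List.length_pos_iff.2 (hσ a)
  have e : ((List.range (n + 1)).map fun i => σ (cons a x i)).flatten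
      = σ a ++ ((List.range n).map fun i => σ (x i)).flatten := by
    simp [List.range_succ_eq_map, Function.comp_def]
  unfold applyMorph
  rw [e]
  split_ifs with hn
  · exact List.getD_append _ _ _ _ hn
  · rw [List.getD_append_right _ _ _ _ (by omega), getD_flatten_range hσ x (by omega)]
    rfl

lemma IsSuffix.map_applyMorph (hσ : ∀ c, σ c ≠ []) {p x : ℕ → Fin k} (h : IsSuffix p x) :
    IsSuffix (applyMorph σ p) (applyMorph σ x) := by
  refine h.induction (P := fun x => IsSuffix (applyMorph σ p) (applyMorph σ x))
    (isSuffix_refl _) fun a y _ hy => ?_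
  rw [applyMorph_cons hσ] at hy
  exact hy.of_foldr_cons

end Morphism

local notation "H" => applyMorph hm
local notation "G" => applyMorph gm

lemma fin_three_cases : ∀ a : Fin 3, a = 0 ∨ a = 1 ∨ a = 2 := by decide

lemma hm_ne_nil : ∀ c, hm c ≠ [] := by decide

lemma gm_ne_nil : ∀ c, gm c ≠ [] := by decide

@[simp] lemma hm_cons_zero (x : ℕ → Fin 3) : H (cons 0 x) = cons 0 (cons 1 (H x)) :=
  applyMorph_cons hm_ne_nil 0 x

@[simp] lemma hm_cons_one (x : ℕ → Fin 3) : H (cons 1 x) = cons 2 (cons 1 (H x)) :=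
  applyMorph_cons hm_ne_nil 1 x

@[simp] lemma hm_cons_two (x : ℕ → Fin 3) : H (cons 2 x) = cons 0 (H x) :=
  applyMorph_cons hm_ne_nil 2 x

@[simp] lemma gm_cons_zero (x : ℕ → Fin 3) : G (cons 0 x) = cons 0 (cons 1 (cons 1 (G x))) :=
  applyMorph_cons gm_ne_nil 0 x

@[simp] lemma gm_cons_one (x : ℕ → Fin 3) : G (cons 1 x) = cons 0 (G x) :=
  applyMorph_cons gm_ne_nil 1 x

@[simp] lemma gm_cons_two (x : ℕ → Fin 3) : G (cons 2 x) = cons 0 (cons 1 (G x)) :=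
  applyMorph_cons gm_ne_nil 2 x

lemma hm_zero_ne_one (x : ℕ → Fin 3) : H x 0 ≠ 1 := by
  obtain ⟨a, x, rfl⟩ := exists_eq_cons x
  rcases fin_three_cases a with rfl | rfl | rfl <;> simp

@[simp] lemma gm_zero (x : ℕ → Fin 3) : G x 0 = 0 := by
  obtain ⟨a, x, rfl⟩ := exists_eq_cons x
  rcases fin_three_cases a with rfl | rfl | rfl <;> simp

/-- The letters which may follow each other in the fixed point of `h`. -/
def Follows (a b : Fin 3) : Prop := (a = 0 → b ≠ 0) ∧ (a = 1 → b ≠ 1) ∧ (a = 2 → b = 1)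

/-- If `u` and `v` split after a common prefix shared with `c`, so that `c` follows one of them
whenever `c` continues with `1`, then so do their images under `h`. -/
lemma hm_exists_split (m : ℕ) : ∀ u v c : ℕ → Fin 3, (∀ t, Follows (u t) (u (t + 1))) →
    (∀ t, Follows (v t) (v (t + 1))) → Agree u v m → u m ≠ v m → Agree u c m →
    (c m = 1 → u m = 1 ∨ v m = 1) → ∃ k, H u k ≠ H v k ∧ Agree (H u) (H c) k := by
  induction m with
  | zero =>
    intro u v c hu hv _ hne _ hc
    have hu0 := hu 0
    have hv0 := hv 0
    obtain ⟨a, u, rfl⟩ := exists_eq_cons u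
    obtain ⟨b, v, rfl⟩ := exists_eq_cons v
    obtain ⟨d, c, rfl⟩ := exists_eq_cons c
    obtain ⟨a', u, rfl⟩ := exists_eq_cons u
    obtain ⟨b', v, rfl⟩ := exists_eq_cons v
    simp only [cons_zero, cons_succ, zero_add] at hu0 hv0 hne hc
    by_cases h1 : a = 1 ∨ b = 1
    · refine ⟨0, ?_, agree_zero _ _⟩
      rcases fin_three_cases a with rfl | rfl | rfl <;>
        rcases fin_three_cases b with rfl | rfl | rfl <;> simp_all
    · refine ⟨1, ?_, ?_⟩ <;>
      rcases fin_three_cases a with rfl | rfl | rfl <;>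
        rcases fin_three_cases b with rfl | rfl | rfl <;>
          rcases fin_three_cases d with rfl | rfl | rfl <;> simp_all [Follows]
  | succ m ih =>
    intro u v c hu hv huv hne huc hc
    obtain ⟨a, u, rfl⟩ := exists_eq_cons u
    obtain ⟨b, v, rfl⟩ := exists_eq_cons v
    obtain ⟨d, c, rfl⟩ := exists_eq_cons c
    obtain ⟨rfl, huv'⟩ := agree_cons.1 huv
    obtain ⟨rfl, huc'⟩ := agree_cons.1 huc
    obtain ⟨k, hk, hk'⟩ := ih u v c (fun t => hu (t + 1)) (fun t => hv (t + 1)) huv' hne huc' hc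
    rcases fin_three_cases a with rfl | rfl | rfl
    · exact ⟨k + 2, by simpa, by simpa⟩
    · exact ⟨k + 2, by simpa, by simpa⟩
    · exact ⟨k + 1, by simpa, by simpa⟩

lemma gm_exists_split (m : ℕ) : ∀ u v c : ℕ → Fin 3, Agree u v m → u m ≠ v m → Agree u c m →
    (c m = 1 → u m = 1 ∨ v m = 1) → ∃ k, G u k ≠ G v k ∧ Agree (G u) (G c) k := by
  induction m with
  | zero =>
    intro u v c _ hne _ hc
    obtain ⟨a, u, rfl⟩ := exists_eq_cons u
    obtain ⟨b, v, rfl⟩ := exists_eq_cons v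
    obtain ⟨d, c, rfl⟩ := exists_eq_cons c
    simp only [cons_zero] at hne hc
    by_cases h1 : a = 1 ∨ b = 1
    · refine ⟨1, ?_, ?_⟩ <;>
      rcases fin_three_cases a with rfl | rfl | rfl <;>
        rcases fin_three_cases b with rfl | rfl | rfl <;>
          rcases fin_three_cases d with rfl | rfl | rfl <;> simp_all [cons]
    · refine ⟨2, ?_, ?_⟩ <;>
      rcases fin_three_cases a with rfl | rfl | rfl <;>
        rcases fin_three_cases b with rfl | rfl | rfl <;>
          rcases fin_three_cases d with rfl | rfl | rfl <;> simp_all [cons]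
  | succ m ih =>
    intro u v c huv hne huc hc
    obtain ⟨a, u, rfl⟩ := exists_eq_cons u
    obtain ⟨b, v, rfl⟩ := exists_eq_cons v
    obtain ⟨d, c, rfl⟩ := exists_eq_cons c
    obtain ⟨rfl, huv'⟩ := agree_cons.1 huv
    obtain ⟨rfl, huc'⟩ := agree_cons.1 huc
    obtain ⟨k, hk, hk'⟩ := ih u v c huv' hne huc' hc
    rcases fin_three_cases a with rfl | rfl | rfl
    · exact ⟨k + 3, by simpa, by simpa⟩
    · exact ⟨k + 1, by simpa, by simpa⟩
    · exact ⟨k + 2, by simpa, by simpa⟩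

lemma agree_hm {m : ℕ} : ∀ {u c : ℕ → Fin 3}, Agree u c m → Agree (H u) (H c) m := by
  induction m with
  | zero => simp
  | succ m ih =>
    intro u c h
    obtain ⟨a, u, rfl⟩ := exists_eq_cons u
    obtain ⟨d, c, rfl⟩ := exists_eq_cons c
    obtain ⟨rfl, h'⟩ := agree_cons.1 h
    have := ih h'
    rcases fin_three_cases a with rfl | rfl | rfl
    · rw [hm_cons_zero, hm_cons_zero]
      exact Agree.mono (n := m + 2) (by simpa) (by omega)
    · rw [hm_cons_one, hm_cons_one]
      exact Agree.mono (n := m + 2) (by simpa) (by omega)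
    · simpa

lemma agree_gm {m : ℕ} : ∀ {u c : ℕ → Fin 3}, Agree u c m → Agree (G u) (G c) m := by
  induction m with
  | zero => simp
  | succ m ih =>
    intro u c h
    obtain ⟨a, u, rfl⟩ := exists_eq_cons u
    obtain ⟨d, c, rfl⟩ := exists_eq_cons c
    obtain ⟨rfl, h'⟩ := agree_cons.1 h
    have := ih h'
    rcases fin_three_cases a with rfl | rfl | rfl
    · rw [gm_cons_zero, gm_cons_zero]
      exact Agree.mono (n := m + 3) (by simpa) (by omega)
    · simpa
    · rw [gm_cons_two, gm_cons_two]
      exact Agree.mono (n := m + 2) (by simpa) (by omega)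

lemma agree_hm_succ {m : ℕ} {u c : ℕ → Fin 3} (h0 : u 0 = c 0) (h2 : c 0 ≠ 2)
    (h : Agree u c m) : Agree (H u) (H c) (m + 1) := by
  obtain ⟨a, u, rfl⟩ := exists_eq_cons u
  obtain ⟨d, c, rfl⟩ := exists_eq_cons c
  obtain rfl : a = d := h0
  have key : Agree (H u) (H c) (m - 1) := by
    rcases m with _ | m
    · simp
    · exact agree_hm (agree_cons.1 h).2
  refine Agree.mono (n := m - 1 + 2) ?_ (by omega)
  rcases fin_three_cases a with rfl | rfl | rfl
  · simpa
  · simpa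
  · simp at h2

lemma hm_zero_eq_two {x : ℕ → Fin 3} (h : H x 0 = 2) : x 0 = 1 := by
  obtain ⟨a, x, rfl⟩ := exists_eq_cons x
  rcases fin_three_cases a with rfl | rfl | rfl <;> simp_all

lemma one_of_follows {u v c : ℕ → Fin 3} (hu : ∀ t, Follows (u t) (u (t + 1)))
    (hv : ∀ t, Follows (v t) (v (t + 1))) (hc : ∀ t, Follows (c t) (c (t + 1))) {m : ℕ}
    (h0 : c 0 = 1 → u 0 = 1 ∨ v 0 = 1) (huv : Agree u v m) (hne : u m ≠ v m) (huc : Agree u c m)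
    (h1 : c m = 1) : u m = 1 ∨ v m = 1 := by
  rcases m with _ | m
  · exact h0 h1
  · have hu := hu m
    have hv := hv m
    have hc := hc m
    rw [← huv m m.lt_succ_self] at hv
    rw [← huc m m.lt_succ_self, h1] at hc
    generalize u (m + 1) = s at *
    generalize v (m + 1) = t at *
    generalize u m = r at *
    clear * - hu hv hc hne
    revert r s t
    unfold Follows
    decide

section FixedPoint

variable {p : ℕ → Fin 3}

lemma IsSuffix.map_hm (hp : H p = p) {x : ℕ → Fin 3} (hx : IsSuffix p x) : IsSuffix p (H x) := by
  have := hx.map_applyMorph hm_ne_nil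
  rwa [hp] at this

lemma IsSuffix.desubst_hm (hp : H p = p) {x : ℕ → Fin 3} (hx : IsSuffix p x) :
    (∃ y, IsSuffix p y ∧ x = H y) ∨
      ∃ c y, c ≠ 2 ∧ IsSuffix p (cons c y) ∧ x = cons 1 (H y) := by
  refine hx.induction (P := fun x => (∃ y, IsSuffix p y ∧ x = H y) ∨
    ∃ c y, c ≠ 2 ∧ IsSuffix p (cons c y) ∧ x = cons 1 (H y)) (Or.inl ⟨p, isSuffix_refl p, hp.symm⟩)
    fun a x _ h => ?_
  rcases h with ⟨y, hy, h⟩ | ⟨c, y, -, hy, h⟩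
  · obtain ⟨b, y, rfl⟩ := exists_eq_cons y
    rcases fin_three_cases b with rfl | rfl | rfl
    · exact Or.inr ⟨0, y, by decide, hy, by simp_all⟩
    · exact Or.inr ⟨1, y, by decide, hy, by simp_all⟩
    · exact Or.inl ⟨y, hy.of_cons, by simp_all⟩
  · exact Or.inl ⟨y, hy.of_cons, by simp_all⟩

lemma IsSuffix.of_two (hp : H p = p) {x : ℕ → Fin 3} (hx : IsSuffix p (cons 2 x)) :
    ∃ y, IsSuffix p (cons 1 y) ∧ x = cons 1 (H y) := by
  rcases hx.desubst_hm hp with ⟨y, hy, h⟩ | ⟨c, y, -, hy, h⟩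
  · obtain ⟨b, y, rfl⟩ := exists_eq_cons y
    rcases fin_three_cases b with rfl | rfl | rfl
    · simp at h
    · exact ⟨y, hy, by simp_all⟩
    · simp at h
  · simp at h

lemma IsSuffix.of_one (hp : H p = p) {x : ℕ → Fin 3} (hx : IsSuffix p (cons 1 x)) :
    ∃ c y, c ≠ 2 ∧ IsSuffix p (cons c y) ∧ x = H y := by
  rcases hx.desubst_hm hp with ⟨y, hy, h⟩ | ⟨c, y, hc, hy, h⟩
  · exact absurd (congrFun h 0).symm (hm_zero_ne_one y)
  · exact ⟨c, y, hc, hy, by simp_all⟩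

lemma IsSuffix.of_zero (hp : H p = p) {x : ℕ → Fin 3} (hx : IsSuffix p (cons 0 x)) :
    (∃ y, IsSuffix p (cons 0 y) ∧ x = cons 1 (H y)) ∨
      ∃ y, IsSuffix p (cons 2 y) ∧ x = H y ∧ x 0 = 2 := by
  rcases hx.desubst_hm hp with ⟨y, hy, h⟩ | ⟨c, y, hc, hy, h⟩
  · obtain ⟨b, y, rfl⟩ := exists_eq_cons y
    rcases fin_three_cases b with rfl | rfl | rfl
    · exact Or.inl ⟨y, hy, by simp_all⟩
    · simp at h
    · obtain ⟨z, -, rfl⟩ := hy.of_two hp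
      exact Or.inr ⟨_, hy, by simp_all⟩
  · simp at h

lemma IsSuffix.follows_zero (hp : H p = p) {a : Fin 3} {x : ℕ → Fin 3}
    (hx : IsSuffix p (cons a x)) : Follows a (x 0) := by
  rcases fin_three_cases a with rfl | rfl | rfl
  · rcases hx.of_zero hp with ⟨y, -, rfl⟩ | ⟨y, -, -, h⟩ <;> simp [Follows, *]
  · obtain ⟨c, y, -, -, rfl⟩ := hx.of_one hp
    simpa [Follows] using hm_zero_ne_one y
  · obtain ⟨y, -, rfl⟩ := hx.of_two hp
    simp [Follows]

lemma IsSuffix.follows (hp : H p = p) {x : ℕ → Fin 3} (hx : IsSuffix p x) (t : ℕ) :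
    Follows (x t) (x (t + 1)) := by
  obtain ⟨a, y, h⟩ := exists_eq_cons fun s => x (t + s)
  have hs := hx.shift t
  rw [h] at hs
  have := hs.follows_zero hp
  rwa [show a = x t from (congrFun h 0).symm, show y 0 = x (t + 1) from (congrFun h 1).symm] at this

/-- If all prefixes of `z` are factors of `p`, then `z` satisfies the same letter constraints. -/
lemma follows_of_prefixes (hp : H p = p) {z : ℕ → Fin 3}
    (hz : ∀ n, ∃ x, IsSuffix p x ∧ Agree x z n) (t : ℕ) : Follows (z t) (z (t + 1)) := by
  obtain ⟨x, hx, h⟩ := hz (t + 2)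
  rw [← h t (by omega), ← h (t + 1) (by omega)]
  exact hx.follows hp t

lemma fixed_eq (hp0 : p 0 = 0) (hp : H p = p) :
    ∃ z, p = cons 0 (cons 1 (cons 2 (cons 1 (cons 0 z)))) := by
  obtain ⟨a, x, rfl⟩ := exists_eq_cons p
  obtain rfl : a = 0 := hp0
  rw [hm_cons_zero, cons_inj] at hp
  have hx := hp.2.symm
  have h2 : H x = cons 2 (cons 1 (H (H x))) := by
    conv_lhs => rw [hx]
    simp
  have h3 : H (H x) = cons 0 (H (cons 1 (H (H x)))) := by
    conv_lhs => rw [h2]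
    simp
  exact ⟨H (cons 1 (H (H x))), by rw [← h3, ← h2, ← hx]⟩

/-- Every prefix of the fixed point of `h` occurs in it at a positive position. -/
lemma fixed_recurrent (hp0 : p 0 = 0) (hp : H p = p) (n : ℕ) :
    ∃ c x, IsSuffix p (cons c x) ∧ x 0 = 0 ∧ Agree x p n := by
  induction n with
  | zero =>
    obtain ⟨z, hz⟩ := fixed_eq hp0 hp
    have h := isSuffix_refl p
    nth_rw 2 [hz] at h
    exact ⟨1, cons 0 z, h.of_cons.of_cons.of_cons, rfl, agree_zero _ _⟩
  | succ n ih =>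
    obtain ⟨c, x, hx, hx0, h⟩ := ih
    have hx' := hx.map_hm hp
    have h' : Agree (H x) (H p) (n + 1) := agree_hm_succ (hx0.trans hp0.symm) (by simp [hp0]) h
    rw [hp] at h'
    have h0 : H x 0 = 0 := (h' 0 n.succ_pos).trans hp0
    rcases fin_three_cases c with rfl | rfl | rfl <;> simp only [hm_cons_zero, hm_cons_one,
      hm_cons_two] at hx'
    · exact ⟨1, H x, hx'.of_cons, h0, h'⟩
    · exact ⟨1, H x, hx'.of_cons, h0, h'⟩
    · exact ⟨0, H x, hx', h0, h'⟩

variable {a b : ℕ → Fin 3}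

lemma exists_isSuffix_zero_two (hp0 : p 0 = 0) (hp : H p = p) (ha : cons 1 (H b) = a)
    (hb : H a = b) (n : ℕ) :
    ∃ x y, IsSuffix p (cons 0 x) ∧ IsSuffix p (cons 2 y) ∧ Agree x a n ∧ Agree y a n := by
  induction n with
  | zero =>
    obtain ⟨z, hz⟩ := fixed_eq hp0 hp
    have h := isSuffix_refl p
    nth_rw 2 [hz] at h
    exact ⟨_, _, h, h.of_cons.of_cons, agree_zero _ _, agree_zero _ _⟩
  | succ n ih =>
    obtain ⟨x, y, hx, hy, hxa, hya⟩ := ih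
    have hx' := (hx.map_hm hp).map_hm hp
    have hy' := (hy.map_hm hp).map_hm hp
    simp only [hm_cons_zero, hm_cons_one, hm_cons_two] at hx' hy'
    refine ⟨_, _, hy', hx'.of_cons.of_cons, ?_, ?_⟩
    · rw [← ha, ← hb, agree_cons]
      exact ⟨rfl, agree_hm (agree_hm hya)⟩
    · rw [← ha, ← hb, agree_cons]
      exact ⟨rfl, agree_hm (agree_hm hxa)⟩

lemma exists_isSuffix_zero_one (hp0 : p 0 = 0) (hp : H p = p) (ha : cons 1 (H b) = a)
    (hb : H a = b) (n : ℕ) :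
    ∃ x y, IsSuffix p (cons 0 x) ∧ IsSuffix p (cons 1 y) ∧ Agree x b n ∧ Agree y b n := by
  obtain ⟨x, y, hx, hy, hxa, hya⟩ := exists_isSuffix_zero_two hp0 hp ha hb n
  have hx' := hx.map_hm hp
  have hy' := hy.map_hm hp
  simp only [hm_cons_zero, hm_cons_two] at hx' hy'
  exact ⟨_, _, hy', hx'.of_cons, hb ▸ agree_hm hya, hb ▸ agree_hm hxa⟩

lemma follows_left_special (hp0 : p 0 = 0) (hp : H p = p) (ha : cons 1 (H b) = a)
    (hb : H a = b) :
    (∀ t, Follows (a t) (a (t + 1))) ∧ ∀ t, Follows (b t) (b (t + 1)) := by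
  constructor
  · refine follows_of_prefixes hp fun n => ?_
    obtain ⟨x, y, hx, -, hxa, -⟩ := exists_isSuffix_zero_two hp0 hp ha hb n
    exact ⟨x, hx.of_cons, hxa⟩
  · refine follows_of_prefixes hp fun n => ?_
    obtain ⟨x, y, hx, -, hxa, -⟩ := exists_isSuffix_zero_one hp0 hp ha hb n
    exact ⟨x, hx.of_cons, hxa⟩

lemma eq_zero_of_agree_one_two (hp : H p = p) {n : ℕ} {x y : ℕ → Fin 3}
    (hx : IsSuffix p (cons 1 x)) (hy : IsSuffix p (cons 2 y)) (h : Agree x y n) : n = 0 := by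
  by_contra hn
  exact (hx.follows_zero hp).2.1 rfl
    ((h 0 (Nat.pos_of_ne_zero hn)).trans ((hy.follows_zero hp).2.2 rfl))

/-- A left special factor of `p` is a prefix of `a` or of `b`, depending on its left extensions. -/
lemma left_special_agree (hp0 : p 0 = 0) (hp : H p = p) (ha : cons 1 (H b) = a) (hb : H a = b)
    (n : ℕ) : ∀ x y, Agree x y n → IsSuffix p (cons 0 x) →
      (IsSuffix p (cons 2 y) → Agree x a n) ∧ (IsSuffix p (cons 1 y) → Agree x b n) := by
  obtain ⟨fa, fb⟩ := follows_left_special hp0 hp ha hb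
  have ha0 : a 0 = 1 := by rw [← ha, cons_zero]
  have hb0 : b 0 = 2 := by
    obtain ⟨d, c, rfl⟩ := exists_eq_cons a
    obtain rfl : d = 1 := ha0
    rw [← hb, hm_cons_one, cons_zero]
  induction n using Nat.strong_induction_on with
  | _ n ih =>
    intro x y hxy hx
    rcases n with _ | n
    · simp
    have hxy0 := hxy 0 n.succ_pos
    refine ⟨fun hy => ?_, fun hy => ?_⟩
    · obtain ⟨v, hv, rfl⟩ := hy.of_two hp
      rcases hx.of_zero hp with ⟨u, hu, rfl⟩ | ⟨u, -, -, h⟩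
      · rw [← ha, agree_cons]
        refine ⟨rfl, ?_⟩
        have huv := (agree_cons.1 hxy).2
        rcases agree_or_exists_ne u v n with h | ⟨m, hm, h, hne⟩
        · exact agree_hm ((ih n n.lt_succ_self u v h hu).2 hv)
        · have hub := (ih m (by omega) u v h hu).2 hv
          have fu := hu.of_cons.follows hp
          have fv := hv.of_cons.follows hp
          obtain ⟨k, hk, hk'⟩ := hm_exists_split m u v b fu fv h hne hub
            (one_of_follows fu fv fb (by simp [hb0]) h hne hub)
          exact hk'.mono (huv.le_of_ne hk)
      · rw [h] at hxy0
        simp at hxy0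
    · obtain ⟨c, v, hc, hv, rfl⟩ := hy.of_one hp
      rcases hx.of_zero hp with ⟨u, -, rfl⟩ | ⟨u, hu, rfl, h2⟩
      · exact absurd hxy0.symm (hm_zero_ne_one v)
      · have hu0 : u 0 = 1 := hm_zero_eq_two h2
        have hv0 : v 0 = 1 := hm_zero_eq_two (hxy0.symm.trans h2)
        have hfv := hv.follows_zero hp
        obtain rfl : c = 0 := by
          rcases fin_three_cases c with rfl | rfl | rfl
          · rfl
          · exact absurd hv0 (hfv.2.1 rfl)
          · exact absurd rfl hc
        rw [← hb]
        rcases agree_or_exists_ne u v n with h | ⟨m, hm, h, hne⟩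
        · exact agree_hm_succ (hu0.trans ha0.symm) (by simp [ha0])
            (h.trans ((ih n n.lt_succ_self v u h.symm hv).1 hu))
        · have hua := h.trans ((ih m (by omega) v u h.symm hv).1 hu)
          have fu := hu.of_cons.follows hp
          have fv := hv.of_cons.follows hp
          obtain ⟨k, hk, hk'⟩ := hm_exists_split m u v a fu fv h hne hua
            (one_of_follows fu fv fa (fun _ => Or.inl hu0) h hne hua)
          exact hk'.mono (hxy.le_of_ne hk)

lemma IsSuffix.desubst_gm {z : ℕ → Fin 2} (hz : IsSuffix (G p) z) :
    (∃ y, IsSuffix p y ∧ z = G y) ∨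
      (∃ y, IsSuffix p (cons 0 y) ∧ z = cons 1 (cons 1 (G y))) ∨
      ∃ c y, c ≠ 1 ∧ IsSuffix p (cons c y) ∧ z = cons 1 (G y) := by
  refine hz.induction (P := fun z => (∃ y, IsSuffix p y ∧ z = G y) ∨
      (∃ y, IsSuffix p (cons 0 y) ∧ z = cons 1 (cons 1 (G y))) ∨
      ∃ c y, c ≠ 1 ∧ IsSuffix p (cons c y) ∧ z = cons 1 (G y))
    (Or.inl ⟨p, isSuffix_refl p, rfl⟩) fun a x _ h => ?_
  rcases h with ⟨y, hy, h⟩ | ⟨y, hy, h⟩ | ⟨c, y, -, hy, h⟩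
  · obtain ⟨b, y, rfl⟩ := exists_eq_cons y
    rcases fin_three_cases b with rfl | rfl | rfl
    · exact Or.inr (Or.inl ⟨y, hy, by simp_all⟩)
    · exact Or.inl ⟨y, hy.of_cons, by simp_all⟩
    · exact Or.inr (Or.inr ⟨2, y, by decide, hy, by simp_all⟩)
  · exact Or.inr (Or.inr ⟨0, y, by decide, hy, by simp_all⟩)
  · exact Or.inl ⟨y, hy.of_cons, by simp_all⟩

lemma IsSuffix.of_zero_gm {x : ℕ → Fin 2} (hx : IsSuffix (G p) (cons 0 x)) :
    (∃ u, IsSuffix p (cons 0 u) ∧ x = cons 1 (cons 1 (G u))) ∨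
      (∃ u, IsSuffix p (cons 1 u) ∧ x = G u) ∨
      ∃ u, IsSuffix p (cons 2 u) ∧ x = cons 1 (G u) := by
  rcases hx.desubst_gm with ⟨y, hy, h⟩ | ⟨y, -, h⟩ | ⟨c, y, -, -, h⟩
  · obtain ⟨b, y, rfl⟩ := exists_eq_cons y
    rcases fin_three_cases b with rfl | rfl | rfl
    · exact Or.inl ⟨y, hy, by simp_all⟩
    · exact Or.inr (Or.inl ⟨y, hy, by simp_all⟩)
    · exact Or.inr (Or.inr ⟨y, hy, by simp_all⟩)
  · simp at h
  · simp at h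

lemma IsSuffix.of_one_gm {x : ℕ → Fin 2} (hx : IsSuffix (G p) (cons 1 x)) :
    (∃ u, IsSuffix p (cons 0 u) ∧ x = cons 1 (G u)) ∨
      ∃ c u, c ≠ 1 ∧ IsSuffix p (cons c u) ∧ x = G u := by
  rcases hx.desubst_gm with ⟨y, hy, h⟩ | ⟨y, hy, h⟩ | ⟨c, y, hc, hy, h⟩
  · simpa using congrFun h 0
  · exact Or.inl ⟨y, hy, by simp_all⟩
  · exact Or.inr ⟨c, y, hc, hy, by simp_all⟩

/-- A left special factor of `g(p)` is a prefix of `1 g(a)` or of `g(b)`. -/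
lemma gm_left_special_agree (hp0 : p 0 = 0) (hp : H p = p) (ha : cons 1 (H b) = a)
    (hb : H a = b) {n : ℕ} {x y : ℕ → Fin 2} (hx : IsSuffix (G p) (cons 0 x))
    (hy : IsSuffix (G p) (cons 1 y)) (hxy : Agree x y n) :
    Agree x (cons 1 (G a)) n ∨ Agree x (G b) n := by
  obtain ⟨fa, fb⟩ := follows_left_special hp0 hp ha hb
  have ha0 : a 0 = 1 := by rw [← ha, cons_zero]
  have hb0 : b 0 = 2 := by
    obtain ⟨d, c, rfl⟩ := exists_eq_cons a
    obtain rfl : d = 1 := ha0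
    rw [← hb, hm_cons_one, cons_zero]
  rcases n with _ | n
  · simp
  have hxy0 := hxy 0 n.succ_pos
  rcases hx.of_zero_gm with ⟨u, hu, rfl⟩ | ⟨u, hu, rfl⟩ | ⟨u, hu, rfl⟩ <;>
    rcases hy.of_one_gm with ⟨v, hv, rfl⟩ | ⟨c, v, hc, hv, rfl⟩
  · left
    rcases n with _ | n
    · simp
    · simpa using hxy 1 (by omega)
  · simp at hxy0
  · simp at hxy0
  · right
    have key : ∀ m, Agree u v m → Agree u b m := by
      intro m h
      rcases fin_three_cases c with rfl | rfl | rfl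
      · exact h.trans ((left_special_agree hp0 hp ha hb m v u h.symm hv).2 hu)
      · exact absurd rfl hc
      · rw [eq_zero_of_agree_one_two hp hu hv h]
        simp
    rcases agree_or_exists_ne u v (n + 1) with h | ⟨m, hm, h, hne⟩
    · exact agree_gm (key _ h)
    · obtain ⟨k, hk, hk'⟩ := gm_exists_split m u v b h hne (key m h)
        (one_of_follows (hu.of_cons.follows hp) (hv.of_cons.follows hp) fb (by simp [hb0]) h hne
          (key m h))
      exact hk'.mono (hxy.le_of_ne hk)
  · left
    have key : ∀ m, Agree u v m → Agree u a m := fun m h =>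
      h.trans ((left_special_agree hp0 hp ha hb m v u h.symm hv).1 hu)
    rw [agree_cons]
    refine ⟨rfl, ?_⟩
    rcases agree_or_exists_ne u v n with h | ⟨m, hm, h, hne⟩
    · exact agree_gm (key _ h)
    · obtain ⟨k, hk, hk'⟩ := gm_exists_split m u v a h hne (key m h)
        (one_of_follows (hu.of_cons.follows hp) (hv.of_cons.follows hp) fa
          (fun _ => Or.inl ((hu.follows_zero hp).2.2 rfl)) h hne (key m h))
      exact hk'.mono ((agree_cons.1 hxy).2.le_of_ne hk)
  · simp at hxy0

end FixedPoint

section Complexity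

/-- The prefix of length `n` of an infinite word. -/
def pref (x : ℕ → A) (n : ℕ) : List A := (List.range n).map x

lemma pref_eq_iff {x y : ℕ → A} {n : ℕ} : pref x n = pref y n ↔ Agree x y n := by
  simp [pref, Agree]

lemma pref_cons (a : A) (x : ℕ → A) (n : ℕ) : pref (cons a x) (n + 1) = a :: pref x n := by
  simp [pref, List.range_succ_eq_map, Function.comp_def]

lemma setOf_isFactor_eq (q : ℕ → A) (n : ℕ) :
    {w : List A | w.length = n ∧ IsFactor q w} = {w | ∃ x, IsSuffix q x ∧ pref x n = w} := by
  ext w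
  constructor
  · rintro ⟨rfl, i, hi⟩
    exact ⟨_, ⟨i, rfl⟩, hi.symm⟩
  · rintro ⟨_, ⟨i, rfl⟩, rfl⟩
    exact ⟨by simp [pref], i, by simp [pref, FactorAt]⟩

/-- The complexity of a recurrent binary word grows by the number of its left special factors. -/
lemma complexity_succ {q : ℕ → Fin 2}
    (hrec : ∀ x n, IsSuffix q x → ∃ a y, IsSuffix q (cons a y) ∧ Agree y x n) (n : ℕ) :
    complexity q (n + 1) = complexity q n + Set.ncard {w | ∃ x y, IsSuffix q (cons 0 x) ∧
      IsSuffix q (cons 1 y) ∧ pref x n = w ∧ pref y n = w} := by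
  let S : Fin 2 → Set (List (Fin 2)) := fun a => {w | ∃ x, IsSuffix q (cons a x) ∧ pref x n = w}
  have hfin : ∀ a, (S a).Finite := fun a =>
    (List.finite_length_eq (Fin 2) n).subset (by rintro _ ⟨x, -, rfl⟩; simp [pref])
  have hsucc : {w | ∃ x, IsSuffix q x ∧ pref x (n + 1) = w}
      = List.cons 0 '' S 0 ∪ List.cons 1 '' S 1 := by
    ext w
    constructor
    · rintro ⟨x, hx, rfl⟩
      obtain ⟨a, x, rfl⟩ := exists_eq_cons x
      rw [pref_cons]
      fin_cases a
      · exact Or.inl ⟨_, ⟨x, hx, rfl⟩, rfl⟩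
      · exact Or.inr ⟨_, ⟨x, hx, rfl⟩, rfl⟩
    · rintro (⟨_, ⟨x, hx, rfl⟩, rfl⟩ | ⟨_, ⟨x, hx, rfl⟩, rfl⟩)
      · exact ⟨_, hx, pref_cons _ _ _⟩
      · exact ⟨_, hx, pref_cons _ _ _⟩
  have hunion : {w | ∃ x, IsSuffix q x ∧ pref x n = w} = S 0 ∪ S 1 := by
    ext w
    constructor
    · rintro ⟨x, hx, rfl⟩
      obtain ⟨a, y, hy, h⟩ := hrec x n hx
      fin_cases a
      · exact Or.inl ⟨y, hy, pref_eq_iff.2 h⟩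
      · exact Or.inr ⟨y, hy, pref_eq_iff.2 h⟩
    · rintro (⟨x, hx, rfl⟩ | ⟨x, hx, rfl⟩) <;> exact ⟨x, hx.of_cons, rfl⟩
  have hinter : {w | ∃ x y, IsSuffix q (cons 0 x) ∧ IsSuffix q (cons 1 y) ∧ pref x n = w ∧
      pref y n = w} = S 0 ∩ S 1 := by
    ext w
    constructor
    · rintro ⟨x, y, hx, hy, hxw, hyw⟩
      exact ⟨⟨x, hx, hxw⟩, y, hy, hyw⟩
    · rintro ⟨⟨x, hx, hxw⟩, y, hy, hyw⟩
      exact ⟨x, y, hx, hy, hxw, hyw⟩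
  have hdisj : Disjoint (List.cons 0 '' S 0) (List.cons 1 '' S 1) := by
    rw [Set.disjoint_left]
    rintro _ ⟨w, -, rfl⟩ ⟨w', -, h⟩
    simp at h
  rw [complexity, complexity, setOf_isFactor_eq, setOf_isFactor_eq, hsucc, hunion, hinter,
    Set.ncard_union_eq hdisj ((hfin 0).image _) ((hfin 1).image _),
    Set.ncard_image_of_injective _ (List.cons_injective),
    Set.ncard_image_of_injective _ (List.cons_injective),
    Set.ncard_union_add_ncard_inter _ _ (hfin 0) (hfin 1)]

lemma complexity_zero (q : ℕ → A) : complexity q 0 = 1 := by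
  rw [complexity, setOf_isFactor_eq, Set.ncard_eq_one]
  refine ⟨[], Set.eq_singleton_iff_unique_mem.2 ⟨⟨q, isSuffix_refl q, rfl⟩, ?_⟩⟩
  rintro _ ⟨x, -, rfl⟩
  rfl

end Complexity

lemma gm_recurrent {p : ℕ → Fin 3} (hp0 : p 0 = 0) (hp : H p = p) (x : ℕ → Fin 2) (n : ℕ)
    (hx : IsSuffix (G p) x) : ∃ a y, IsSuffix (G p) (cons a y) ∧ Agree y x n := by
  obtain ⟨i, rfl⟩ := hx
  rcases i with _ | i
  · obtain ⟨c, y, hy, -, h⟩ := fixed_recurrent hp0 hp n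
    have hy' := hy.map_applyMorph gm_ne_nil
    have h' : Agree (G y) (fun t => G p (0 + t)) n := by simpa using agree_gm h
    rcases fin_three_cases c with rfl | rfl | rfl <;> simp only [gm_cons_zero, gm_cons_one,
      gm_cons_two] at hy'
    · exact ⟨1, _, hy'.of_cons.of_cons, h'⟩
    · exact ⟨0, _, hy', h'⟩
    · exact ⟨1, _, hy'.of_cons, h'⟩
  · refine ⟨G p i, _, ⟨i, funext fun t => ?_⟩, agree_refl _ n⟩
    cases t with
    | zero => rfl
    | succ t => exact congrArg (G p) (by omega)

lemma gm_left_special_eq {p a b : ℕ → Fin 3} (hp0 : p 0 = 0) (hp : H p = p)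
    (ha : cons 1 (H b) = a) (hb : H a = b) (n : ℕ) :
    {w | ∃ x y, IsSuffix (G p) (cons 0 x) ∧ IsSuffix (G p) (cons 1 y) ∧ pref x n = w ∧
      pref y n = w} = {pref (cons 1 (G a)) n, pref (G b) n} := by
  ext w
  constructor
  · rintro ⟨x, y, hx, hy, rfl, h⟩
    simpa only [Set.mem_insert_iff, Set.mem_singleton_iff, pref_eq_iff] using
      gm_left_special_agree hp0 hp ha hb hx hy (pref_eq_iff.1 h).symm
  · rintro (rfl | rfl)
    · obtain ⟨x, y, hx, hy, hxa, hya⟩ := exists_isSuffix_zero_two hp0 hp ha hb n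
      have hx' := hx.map_applyMorph gm_ne_nil
      have hy' := hy.map_applyMorph gm_ne_nil
      simp only [gm_cons_zero, gm_cons_two] at hx' hy'
      exact ⟨_, _, hy', hx'.of_cons,
        pref_eq_iff.2 (Agree.mono (agree_cons.2 ⟨rfl, agree_gm hya⟩) n.le_succ),
        pref_eq_iff.2 (Agree.mono (agree_cons.2 ⟨rfl, agree_gm hxa⟩) n.le_succ)⟩
    · obtain ⟨x, y, hx, hy, hxb, hyb⟩ := exists_isSuffix_zero_one hp0 hp ha hb n
      have hx' := hx.map_applyMorph gm_ne_nil
      have hy' := hy.map_applyMorph gm_ne_nil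
      simp only [gm_cons_zero, gm_cons_one] at hx' hy'
      exact ⟨_, _, hy', hx'.of_cons.of_cons, pref_eq_iff.2 (agree_gm hyb),
        pref_eq_iff.2 (agree_gm hxb)⟩

end InfiniteWord

open InfiniteWord

/-- The word `q = g(p)` has factor complexity exactly `2n` for all `n ≥ 1`. -/
theorem stmt4 (p : ℕ → Fin 3) (hp0 : p 0 = 0) (hpfix : applyMorph hm p = p) :
    ∀ n, 1 ≤ n → complexity (applyMorph gm p) n = 2 * n := by
  obtain ⟨a, ha⟩ := exists_fixed_of_agree_succ (fun x => cons 1 (applyMorph hm (applyMorph hm x)))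
    fun x y n h => agree_cons.2 ⟨rfl, agree_hm (agree_hm h)⟩
  have hsucc := complexity_succ (gm_recurrent hp0 hpfix)
  simp only [gm_left_special_eq hp0 hpfix ha rfl] at hsucc
  intro n hn
  induction n, hn using Nat.le_induction with
  | base => simp [hsucc, complexity_zero, pref]
  | succ n hn ih =>
    rw [hsucc, ih, Set.ncard_pair]
    · ring
    · rw [Ne, pref_eq_iff]
      intro h
      simpa using h 0 hn
end
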